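/- arXiv:2309.03662 — 4 statements merged into one kernel-verified Lean document; each statement's English description precedes it below -/
import Mathlib

section
/- Let f : Ω ⊂ ℝ^d → ℝ be bounded and continuous almost everywhere on a regular set Ω with μ_d(Ω) > 0, and assume ER(f) = [inf_Ω f, sup_Ω f]. Let [a,b] be a closed d-dimensional rectangle containing Ω, let n ↦ 𝐧(n) ∈ ℕ^d satisfy min(𝐧(n)) → ∞ as n → ∞, and for every n let {x_{𝐢,𝐧}^{(n)} : 𝐢 = 𝟏,…,𝐧} be an asymptotically uniform grid in [a,b], i.e. max_{𝐢=𝟏,…,𝐧} ‖x_{𝐢,𝐧}^{(n)} − (a + 𝐢(b−a)/𝐧)‖_∞ → 0 (componentwise multi-index operations). Set I_𝐧^{(n)}(Ω) = {𝐢 ∈ {𝟏,…,𝐧} : x_{𝐢,𝐧}^{(n)} ∈ Ω}, and for every n let {λ_{𝐢,𝐧}^{(n)} : 𝐢 ∈ I_𝐧^{(n)}(Ω)} be a multiset of |I_𝐧^{(n)}(Ω)| real numbers such that (i) the sequence of multisets {λ_{𝐢,𝐧}^{(n)} : 𝐢 ∈ I_𝐧^{(n)}(Ω)} has asymptotic distribution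 described by f, and (ii) {λ_{𝐢,𝐧}^{(n)} : 𝐢 ∈ I_𝐧^{(n)}(Ω)} ⊆ [inf_Ω f − ε_n, sup_Ω f + ε_n] for every n, for some ε_n → 0. Then, if σ_n and τ_n are permutations of I_𝐧^{(n)}(Ω) such that the vectors [f(x_{σ_n(𝐢),𝐧}^{(n)})]_{𝐢 ∈ I_𝐧^{(n)}(Ω)} and [λ_{τ_n(𝐢),𝐧}^{(n)}]_{𝐢 ∈ I_𝐧^{(n)}(Ω)} are sorted in increasing order (with respect to the lexicographic ordering of multi-indices), one has max_{𝐢 ∈ I_𝐧^{(n)}(Ω)} |f(x_{σ_n(𝐢),𝐧}^{(n)}) − λ_{τ_n(𝐢),𝐧}^{(n)}| → 0 as n → ∞. -/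
open MeasureTheory Filter
open scoped Classical

/-- The continuous ramp equal to `1` on `(-∞, t]`, to `0` on `[t + h, ∞)`, affine in between. -/
noncomputable def ramp (t h y : ℝ) : ℝ := max 0 (min 1 ((t + h - y) / h))

lemma continuous_ramp (t h : ℝ) : Continuous (ramp t h) := by
  unfold ramp
  fun_prop

lemma ramp_nonneg (t h y : ℝ) : 0 ≤ ramp t h y := le_max_left _ _

lemma ramp_le_one (t h y : ℝ) : ramp t h y ≤ 1 :=
  max_le zero_le_one (min_le_left _ _)

lemma ramp_eq_one {t h y : ℝ} (hh : 0 < h) (hy : y ≤ t) : ramp t h y = 1 := by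
  have : 1 ≤ (t + h - y) / h := by
    rw [le_div_iff₀ hh]
    linarith
  simp [ramp, this]

lemma ramp_eq_zero {t h y : ℝ} (hh : 0 < h) (hy : t + h ≤ y) : ramp t h y = 0 := by
  have : (t + h - y) / h ≤ 0 := div_nonpos_of_nonpos_of_nonneg (by linarith) hh.le
  exact max_eq_left ((min_le_right _ _).trans this)

lemma integrable_ramp (ν : Measure ℝ) [IsFiniteMeasure ν] (t h : ℝ) :
    Integrable (ramp t h) ν := by
  refine Integrable.of_bound (continuous_ramp t h).aestronglyMeasurable 1 (.of_forall fun y => ?_)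
  rw [Real.norm_of_nonneg (ramp_nonneg t h y)]
  exact ramp_le_one t h y

lemma integral_ramp_lt (ν : Measure ℝ) [IsFiniteMeasure ν] {t h : ℝ} (hh : 0 < h)
    (hpos : 0 < ν (Metric.ball (t + 2 * h) h)) :
    ∫ y, ramp t h y ∂ν < ∫ y, ramp (t + 3 * h) h y ∂ν := by
  have hle : ∀ y, ramp t h y ≤ ramp (t + 3 * h) h y := fun y => by
    unfold ramp
    gcongr
    linarith
  rw [← sub_pos, ← integral_sub (integrable_ramp ν _ _) (integrable_ramp ν _ _),
    integral_pos_iff_support_of_nonneg (fun y => sub_nonneg.2 (hle y))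
      ((integrable_ramp ν _ _).sub (integrable_ramp ν _ _))]
  refine hpos.trans_le (measure_mono fun y hy => ?_)
  rw [Metric.mem_ball, Real.dist_eq, abs_lt] at hy
  have h0 : ramp t h y = 0 := ramp_eq_zero hh (by linarith)
  have h1 : ramp (t + 3 * h) h y = 1 := ramp_eq_one hh (by linarith)
  simp [h0, h1]

/-- If a monotone vector `v` takes at index `m` a value at most `t`, while a monotone vector `u`
takes at `m` a value at least `t'+h`, then the ramp at `t` sums over `v` to strictly more than
the ramp at `t'` sums over `u`. -/
lemma sum_ramp_lt_sum_ramp {D : ℕ} {u v : Fin D → ℝ} (hu : Monotone u) (hv : Monotone v)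
    {t t' h : ℝ} (hh : 0 < h) {m : Fin D} (hvm : v m ≤ t) (hum : t' + h ≤ u m) :
    ∑ i, ramp t' h (u i) < ∑ i, ramp t h (v i) := by
  have h1 : ∑ i, ramp t' h (u i) ≤ (m : ℝ) := by
    calc ∑ i, ramp t' h (u i) = ∑ i ∈ Finset.Iio m, ramp t' h (u i) := by
          refine (Finset.sum_subset (Finset.subset_univ _) fun i _ hi => ?_).symm
          rw [Finset.mem_Iio, not_lt] at hi
          exact ramp_eq_zero hh (hum.trans (hu hi))
      _ ≤ ∑ _i ∈ Finset.Iio m, (1 : ℝ) := Finset.sum_le_sum fun i _ => ramp_le_one _ _ _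
      _ = m := by simp
  have h2 : (m : ℝ) + 1 ≤ ∑ i, ramp t h (v i) := by
    calc (m : ℝ) + 1 = ∑ _i ∈ Finset.Iic m, (1 : ℝ) := by simp
      _ = ∑ i ∈ Finset.Iic m, ramp t h (v i) := by
          refine Finset.sum_congr rfl fun i hi => (ramp_eq_one hh ?_).symm
          exact (hv (Finset.mem_Iic.1 hi)).trans hvm
      _ ≤ ∑ i, ramp t h (v i) :=
          Finset.sum_le_sum_of_subset_of_nonneg (Finset.subset_univ _)
            fun i _ _ => ramp_nonneg _ _ _
  linarith

/-- Two sequences of sorted vectors with the same asymptotic distribution `ν`, whose support is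
the interval `[A, B]` approached by all entries, are eventually uniformly close from one side. -/
lemma eventually_le_add_of_same_distribution (ν : Measure ℝ) [IsFiniteMeasure ν] {A B c : ℝ}
    (hc : 0 < c) (hν : ∀ z ∈ Set.Icc A B, ∀ r > 0, 0 < ν (Metric.ball z r))
    (D : ℕ → ℕ) (u v : ∀ n, Fin (D n) → ℝ) (hu : ∀ n, Monotone (u n)) (hv : ∀ n, Monotone (v n))
    (hud : ∀ φ : ℝ → ℝ, Continuous φ →
      Tendsto (fun n => (D n : ℝ)⁻¹ * ∑ m, φ (u n m)) atTop (nhds (c * ∫ y, φ y ∂ν)))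
    (hvd : ∀ φ : ℝ → ℝ, Continuous φ →
      Tendsto (fun n => (D n : ℝ)⁻¹ * ∑ m, φ (v n m)) atTop (nhds (c * ∫ y, φ y ∂ν)))
    {ε : ℕ → ℝ} (hε : Tendsto ε atTop (nhds 0))
    (hub : ∀ n m, u n m ≤ B + ε n) (hvb : ∀ n m, A - ε n ≤ v n m)
    {δ : ℝ} (hδ : 0 < δ) : ∀ᶠ n in atTop, ∀ m, u n m ≤ v n m + δ := by
  obtain ⟨h, hh, rfl⟩ : ∃ h > 0, δ = 8 * h := ⟨δ / 8, by positivity, by ring⟩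
  have hfin : {k : ℤ | k * h + 2 * h ∈ Set.Icc A B}.Finite := by
    refine (Set.finite_Icc ⌊(A - 2 * h) / h⌋ ⌈(B - 2 * h) / h⌉).subset fun k hk => ⟨?_, ?_⟩
    · have : (A - 2 * h) / h ≤ k := by
        rw [div_le_iff₀ hh]
        linarith [hk.1]
      exact_mod_cast (Int.floor_le _).trans this
    · have : k ≤ (B - 2 * h) / h := by
        rw [le_div_iff₀ hh]
        linarith [hk.2]
      exact_mod_cast this.trans (Int.le_ceil _)
  have hev : ∀ᶠ n in atTop, ∀ k ∈ {k : ℤ | k * h + 2 * h ∈ Set.Icc A B},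
      (D n : ℝ)⁻¹ * ∑ m, ramp (k * h) h (v n m) <
        (D n : ℝ)⁻¹ * ∑ m, ramp (k * h + 3 * h) h (u n m) := by
    rw [eventually_all_finite hfin]
    intro k hk
    exact (hvd _ (continuous_ramp _ _)).eventually_lt (hud _ (continuous_ramp _ _))
      (mul_lt_mul_of_pos_left (integral_ramp_lt ν hh (hν _ hk h hh)) hc)
  filter_upwards [hev, hε.eventually_le_const hh] with n hn hεn m
  by_contra! hlt
  have hA := hvb n m
  have hB := hub n m
  have hk1 := Int.floor_le (v n m / h)
  have hk2 := Int.lt_floor_add_one (v n m / h)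
  rw [le_div_iff₀ hh] at hk1
  rw [div_lt_iff₀ hh] at hk2
  have hk := hn (⌊v n m / h⌋ + 2) (by
    simp only [Set.mem_Icc]
    push_cast
    constructor <;> linarith)
  push_cast at hk
  have hsum := sum_ramp_lt_sum_ramp (hu n) (hv n) (t := (⌊v n m / h⌋ + 2) * h)
    (t' := (⌊v n m / h⌋ + 2) * h + 3 * h) hh (m := m) (by linarith) (by linarith)
  exact absurd hk (not_lt.2 (mul_le_mul_of_nonneg_left hsum.le (by positivity)))

lemma ae_continuousAt_indicator {d : ℕ} {Ω : Set (Fin d → ℝ)} (hΩreg : volume (frontier Ω) = 0)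
    {f : (Fin d → ℝ) → ℝ}
    (hfcont : ∀ᵐ x ∂(volume.restrict Ω), ContinuousWithinAt f Ω x) :
    ∀ᵐ x, ContinuousAt (Ω.indicator f) x := by
  have hfr : ∀ᵐ x, x ∉ frontier Ω := measure_eq_zero_iff_ae_notMem.1 hΩreg
  have hc := (ae_restrict_iff'₀ (nullMeasurableSet_of_null_frontier hΩreg)).1 hfcont
  filter_upwards [hfr, hc] with x hx hcx
  by_cases hxΩ : x ∈ closure Ω
  · have hint : x ∈ interior Ω := by
      by_contra h
      exact hx ⟨hxΩ, h⟩
    have hmem := mem_interior_iff_mem_nhds.1 hint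
    refine ((hcx (interior_subset hint)).continuousAt hmem).congr ?_
    filter_upwards [hmem] with y hy
    rw [Set.indicator_of_mem hy]
  · refine (continuousAt_const (y := (0 : ℝ))).congr ?_
    filter_upwards [isClosed_closure.isOpen_compl.mem_nhds hxΩ] with y hy
    rw [Set.indicator_of_notMem fun h => hy (subset_closure h)]

lemma aestronglyMeasurable_of_ae_continuousAt {d : ℕ} {g : (Fin d → ℝ) → ℝ}
    (hg : ∀ᵐ x, ContinuousAt g x) : AEStronglyMeasurable g volume := by
  have hC : MeasurableSet {x | ContinuousAt g x} := (IsGδ.setOfPred_continuousAt g).measurableSet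
  have h : ContinuousOn g {x | ContinuousAt g x} := fun x hx => ContinuousAt.continuousWithinAt hx
  have := h.aestronglyMeasurable (μ := volume) hC
  rwa [Measure.restrict_eq_self_of_ae_mem (s := {x | ContinuousAt g x}) hg] at this

/-- The half-open cell with index `i` of the grid with origin `a` and mesh sizes `w`. -/
def gridCell {d : ℕ} (a w : Fin d → ℝ) (i : Fin d → ℕ) : Set (Fin d → ℝ) :=
  Set.univ.pi fun j => Set.Ico (a j + i j * w j) (a j + (i j + 1) * w j)

lemma measurableSet_gridCell {d : ℕ} (a w : Fin d → ℝ) (i : Fin d → ℕ) :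
    MeasurableSet (gridCell a w i) :=
  MeasurableSet.univ_pi fun _ => measurableSet_Ico

lemma volume_real_gridCell {d : ℕ} {a w : Fin d → ℝ} (hw : ∀ j, 0 < w j) (i : Fin d → ℕ) :
    volume.real (gridCell a w i) = ∏ j, w j := by
  have h : ∀ j, a j + ((i j : ℝ) + 1) * w j - (a j + i j * w j) = w j := fun j => by ring
  rw [gridCell, Measure.real, Real.volume_pi_Ico_toReal]
  · simp_rw [h]
  · intro j
    linarith [h j, hw j]

lemma mem_gridCell_iff {d : ℕ} {a w : Fin d → ℝ} (hw : ∀ j, 0 < w j) {i : Fin d → ℕ}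
    {y : Fin d → ℝ} (hy : ∀ j, a j ≤ y j) :
    y ∈ gridCell a w i ↔ i = fun j => ⌊(y j - a j) / w j⌋₊ := by
  simp only [gridCell, Set.mem_univ_pi, Set.mem_Ico, funext_iff]
  refine forall_congr' fun j => ?_
  rw [eq_comm, Nat.floor_eq_iff (div_nonneg (sub_nonneg.2 (hy j)) (hw j).le), le_div_iff₀ (hw j),
    div_lt_iff₀ (hw j)]
  constructor <;> rintro ⟨h1, h2⟩ <;> constructor <;> linarith

lemma le_of_mem_gridCell {d : ℕ} {a w : Fin d → ℝ} (hw : ∀ j, 0 < w j) {i : Fin d → ℕ}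
    {y : Fin d → ℝ} (hy : y ∈ gridCell a w i) (j : Fin d) : a j ≤ y j := by
  have h := (hy j (Set.mem_univ j)).1
  have : 0 ≤ (i j : ℝ) * w j := mul_nonneg (Nat.cast_nonneg _) (hw j).le
  linarith

lemma lt_of_mem_gridCell {d : ℕ} {a b : Fin d → ℝ} (hab : ∀ j, a j < b j) {N : Fin d → ℕ}
    (hN : ∀ j, 0 < N j) (i : ∀ j, Fin (N j)) {y : Fin d → ℝ}
    (hy : y ∈ gridCell a (fun j => (b j - a j) / N j) (fun j => i j)) (j : Fin d) :
    y j < b j := by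
  have h := (hy j (Set.mem_univ j)).2
  have hNj : (0 : ℝ) < N j := Nat.cast_pos.2 (hN j)
  have hi : ((i j : ℕ) : ℝ) + 1 ≤ N j := by exact_mod_cast (i j).2
  have : (((i j : ℕ) : ℝ) + 1) * ((b j - a j) / N j) ≤ N j * ((b j - a j) / N j) :=
    mul_le_mul_of_nonneg_right hi (div_nonneg (sub_nonneg.2 (hab j).le) hNj.le)
  rw [mul_div_cancel₀ _ hNj.ne'] at this
  linarith

/-- The step function taking the value `c i` on the cell with index `i` of the `N`-grid of the
box `[a, b)`. -/
noncomputable def gridStep {d : ℕ} (a b : Fin d → ℝ) (N : Fin d → ℕ) (c : (∀ j, Fin (N j)) → ℝ)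
    (y : Fin d → ℝ) : ℝ :=
  ∑ i, (gridCell a (fun j => (b j - a j) / N j) (fun j => i j)).indicator (fun _ => c i) y

lemma gridStep_eq_of_mem {d : ℕ} {a b : Fin d → ℝ} (hab : ∀ j, a j < b j) {N : Fin d → ℕ}
    (hN : ∀ j, 0 < N j) (c : (∀ j, Fin (N j)) → ℝ) {y : Fin d → ℝ} {i : ∀ j, Fin (N j)}
    (hy : y ∈ gridCell a (fun j => (b j - a j) / N j) (fun j => i j)) :
    gridStep a b N c y = c i := by
  have hw : ∀ j, 0 < (b j - a j) / N j := fun j =>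
    div_pos (sub_pos.2 (hab j)) (Nat.cast_pos.2 (hN j))
  have hay := le_of_mem_gridCell hw hy
  rw [gridStep, Finset.sum_eq_single i, Set.indicator_of_mem hy]
  · intro k _ hk
    refine Set.indicator_of_notMem (fun hyk => hk ?_) _
    have h := ((mem_gridCell_iff hw hay).1 hyk).trans ((mem_gridCell_iff hw hay).1 hy).symm
    funext j
    exact Fin.ext (congrFun h j)
  · simp

lemma exists_mem_gridCell {d : ℕ} {a b : Fin d → ℝ} (hab : ∀ j, a j < b j) {N : Fin d → ℕ}
    (hN : ∀ j, 0 < N j) {y : Fin d → ℝ} (hy : y ∈ Set.univ.pi fun j => Set.Ico (a j) (b j)) :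
    ∃ i : ∀ j, Fin (N j), y ∈ gridCell a (fun j => (b j - a j) / N j) (fun j => i j) := by
  have hw : ∀ j, 0 < (b j - a j) / N j := fun j =>
    div_pos (sub_pos.2 (hab j)) (Nat.cast_pos.2 (hN j))
  have hay : ∀ j, a j ≤ y j := fun j => (hy j (Set.mem_univ j)).1
  refine ⟨fun j => ⟨⌊(y j - a j) / ((b j - a j) / N j)⌋₊, ?_⟩,
    (mem_gridCell_iff hw hay).2 rfl⟩
  rw [Nat.floor_lt (div_nonneg (sub_nonneg.2 (hay j)) (hw j).le), div_lt_iff₀ (hw j),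
    mul_div_cancel₀ _ (Nat.cast_pos.2 (hN j)).ne']
  linarith [(hy j (Set.mem_univ j)).2]

lemma gridStep_eq_zero {d : ℕ} {a b : Fin d → ℝ} (hab : ∀ j, a j < b j) {N : Fin d → ℕ}
    (hN : ∀ j, 0 < N j) (c : (∀ j, Fin (N j)) → ℝ) {y : Fin d → ℝ}
    (hy : y ∉ Set.univ.pi fun j => Set.Ico (a j) (b j)) : gridStep a b N c y = 0 := by
  refine Finset.sum_eq_zero fun i _ => Set.indicator_of_notMem (fun h => hy fun j _ => ?_) _
  exact ⟨le_of_mem_gridCell (fun j => div_pos (sub_pos.2 (hab j)) (Nat.cast_pos.2 (hN j))) h j,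
    lt_of_mem_gridCell hab hN i h j⟩

lemma volume_gridCell_ne_top {d : ℕ} (a w : Fin d → ℝ) (i : Fin d → ℕ) :
    volume (gridCell a w i) ≠ ⊤ := by
  rw [gridCell, Real.volume_pi_Ico]
  exact ENNReal.prod_ne_top fun _ _ => ENNReal.ofReal_ne_top

lemma integrable_gridStep {d : ℕ} (a b : Fin d → ℝ) (N : Fin d → ℕ) (c : (∀ j, Fin (N j)) → ℝ) :
    Integrable (gridStep a b N c) := by
  refine integrable_finsetSum _ fun i _ => ?_
  exact (integrable_indicator_iff (measurableSet_gridCell _ _ _)).2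
    (integrableOn_const (volume_gridCell_ne_top _ _ _))

lemma integral_gridStep {d : ℕ} {a b : Fin d → ℝ} (hab : ∀ j, a j < b j) {N : Fin d → ℕ}
    (hN : ∀ j, 0 < N j) (c : (∀ j, Fin (N j)) → ℝ) :
    ∫ y, gridStep a b N c y = (∏ j, (b j - a j) / N j) * ∑ i, c i := by
  have hw : ∀ j, 0 < (b j - a j) / N j := fun j =>
    div_pos (sub_pos.2 (hab j)) (Nat.cast_pos.2 (hN j))
  simp only [gridStep]
  rw [integral_finsetSum, Finset.mul_sum]
  · refine Finset.sum_congr rfl fun i _ => ?_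
    rw [integral_indicator_const _ (measurableSet_gridCell _ _ _), volume_real_gridCell hw,
      smul_eq_mul]
  · exact fun i _ => (integrable_indicator_iff (measurableSet_gridCell _ _ _)).2
      (integrableOn_const (volume_gridCell_ne_top _ _ _))

/-- Riemann sums of a bounded, almost everywhere continuous function supported in a box, sampled
on an asymptotically uniform grid, converge to the integral. -/
lemma tendsto_riemannSum {d : ℕ} {a b : Fin d → ℝ} (hab : ∀ j, a j < b j)
    (N : ℕ → Fin d → ℕ) (hN : ∀ j, Tendsto (fun n => N n j) atTop atTop)
    (x : ∀ n, (∀ j, Fin (N n j)) → (Fin d → ℝ))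
    (hau : Tendsto (fun n => ⨆ i : ∀ j, Fin (N n j), ⨆ j : Fin d,
        |x n i j - (a j + (((i j : ℕ) : ℝ) + 1) * (b j - a j) / (N n j : ℝ))|)
      atTop (nhds 0))
    {g : (Fin d → ℝ) → ℝ} (hgc : ∀ᵐ y, ContinuousAt g y) {C : ℝ} (hgC : ∀ y, |g y| ≤ C)
    (hg0 : ∀ y ∉ Set.Icc a b, g y = 0) :
    Tendsto (fun n => (∏ j, (b j - a j) / N n j) * ∑ i, g (x n i)) atTop
      (nhds (∫ y, g y)) := by
  have hNpos : ∀ᶠ n in atTop, ∀ j, 0 < N n j :=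
    eventually_all.2 fun j => (hN j).eventually_gt_atTop 0
  have hC : 0 ≤ C := (abs_nonneg _).trans (hgC a)
  set box : Set (Fin d → ℝ) := Set.univ.pi fun j => Set.Ico (a j) (b j) with hbox
  have hboxmeas : MeasurableSet box := MeasurableSet.univ_pi fun _ => measurableSet_Ico
  have hboxfin : volume box ≠ ⊤ := by
    rw [hbox, Real.volume_pi_Ico]
    exact ENNReal.prod_ne_top fun _ _ => ENNReal.ofReal_ne_top
  have hboxae : ∀ᵐ y : Fin d → ℝ, y ∈ box ↔ y ∈ Set.Icc a b :=
    (Measure.univ_pi_Ico_ae_eq_Icc (μ := fun _ : Fin d => (volume : Measure ℝ))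
      (f := a) (g := b)).mem_iff
  have key : Tendsto (fun n => ∫ y, gridStep a b (N n) (fun i => g (x n i)) y) atTop
      (nhds (∫ y, g y)) := by
    refine tendsto_integral_filter_of_dominated_convergence (box.indicator fun _ => C)
      (.of_forall fun n => (integrable_gridStep _ _ _ _).aestronglyMeasurable) ?_
      ((integrable_indicator_iff hboxmeas).2 (integrableOn_const hboxfin)) ?_
    · filter_upwards [hNpos] with n hn
      refine .of_forall fun y => ?_
      by_cases hy : y ∈ box
      · obtain ⟨i, hi⟩ := exists_mem_gridCell hab hn hy
        rw [gridStep_eq_of_mem hab hn _ hi, Set.indicator_of_mem hy]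
        exact hgC _
      · rw [gridStep_eq_zero hab hn _ hy, Set.indicator_of_notMem hy, norm_zero]
    · filter_upwards [hgc, hboxae] with y hyc hyb
      by_cases hy : y ∈ box
      · have hex : ∀ n, ∃ p : Fin d → ℝ, (∀ j, 0 < N n j) →
            gridStep a b (N n) (fun i => g (x n i)) y = g p ∧
            ∀ j, |p j - y j| ≤ (⨆ i : ∀ j, Fin (N n j), ⨆ j : Fin d,
              |x n i j - (a j + (((i j : ℕ) : ℝ) + 1) * (b j - a j) / (N n j : ℝ))|)
                + (b j - a j) / N n j := by
          intro n
          by_cases hn : ∀ j, 0 < N n j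
          · obtain ⟨i, hi⟩ := exists_mem_gridCell hab hn hy
            refine ⟨x n i, fun _ => ⟨gridStep_eq_of_mem hab hn _ hi, fun j => ?_⟩⟩
            have h1 : |x n i j - (a j + (((i j : ℕ) : ℝ) + 1) * (b j - a j) / (N n j : ℝ))| ≤
                ⨆ i : ∀ j, Fin (N n j), ⨆ j : Fin d,
                  |x n i j - (a j + (((i j : ℕ) : ℝ) + 1) * (b j - a j) / (N n j : ℝ))| :=
              (le_ciSup (f := fun j => |x n i j -
                (a j + (((i j : ℕ) : ℝ) + 1) * (b j - a j) / (N n j : ℝ))|)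
                (Set.finite_range _).bddAbove j).trans
                (le_ciSup (f := fun i : ∀ j, Fin (N n j) => ⨆ j : Fin d, |x n i j -
                  (a j + (((i j : ℕ) : ℝ) + 1) * (b j - a j) / (N n j : ℝ))|)
                  (Set.finite_range _).bddAbove i)
            have h2 : |(a j + (((i j : ℕ) : ℝ) + 1) * (b j - a j) / (N n j : ℝ)) - y j| ≤
                (b j - a j) / N n j := by
              obtain ⟨h3, h4⟩ := hi j (Set.mem_univ j)
              rw [mul_div_assoc, abs_le]
              constructor <;> linarith
            exact (abs_sub_le _ _ _).trans (add_le_add h1 h2)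
          · exact ⟨0, fun h => absurd h hn⟩
        choose p hp using hex
        have hpy : Tendsto p atTop (nhds y) := by
          rw [tendsto_pi_nhds]
          intro j
          rw [tendsto_iff_dist_tendsto_zero]
          have hlim := hau.add (tendsto_const_nhds (x := b j - a j) |>.div_atTop
            (tendsto_natCast_atTop_atTop.comp (hN j)))
          rw [add_zero] at hlim
          refine squeeze_zero' (.of_forall fun _ => dist_nonneg) ?_ hlim
          filter_upwards [hNpos] with n hn
          exact (hp n hn).2 j
        refine (hyc.tendsto.comp hpy).congr' ?_
        filter_upwards [hNpos] with n hn
        exact ((hp n hn).1).symm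
      · rw [hg0 y (mt hyb.2 hy)]
        refine tendsto_const_nhds.congr' ?_
        filter_upwards [hNpos] with n hn
        exact (gridStep_eq_zero hab hn _ hy).symm
  refine key.congr' ?_
  filter_upwards [hNpos] with n hn
  exact integral_gridStep hab hn _

lemma tendsto_average_samples {d : ℕ} {Ω : Set (Fin d → ℝ)} (hΩreg : volume (frontier Ω) = 0)
    (hΩpos : 0 < volume Ω) {a b : Fin d → ℝ} (hab : ∀ j, a j < b j) (hΩab : Ω ⊆ Set.Icc a b)
    {g : (Fin d → ℝ) → ℝ} {C : ℝ} (hgC : ∀ y ∈ Ω, |g y| ≤ C)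
    (hgcont : ∀ᵐ y ∂(volume.restrict Ω), ContinuousWithinAt g Ω y)
    (N : ℕ → Fin d → ℕ) (hN : ∀ j, Tendsto (fun n => N n j) atTop atTop)
    (x : ∀ n, (∀ j, Fin (N n j)) → (Fin d → ℝ))
    (hau : Tendsto (fun n => ⨆ i : ∀ j, Fin (N n j), ⨆ j : Fin d,
        |x n i j - (a j + (((i j : ℕ) : ℝ) + 1) * (b j - a j) / (N n j : ℝ))|)
      atTop (nhds 0)) :
    Tendsto (fun n => (Fintype.card {i : ∀ j, Fin (N n j) // x n i ∈ Ω} : ℝ)⁻¹ *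
        ∑ i : {i : ∀ j, Fin (N n j) // x n i ∈ Ω}, g (x n i.1)) atTop
      (nhds ((volume Ω).toReal⁻¹ * ∫ y in Ω, g y)) := by
  have hnull := nullMeasurableSet_of_null_frontier hΩreg
  have main : ∀ (k : (Fin d → ℝ) → ℝ) (K : ℝ), (∀ y ∈ Ω, |k y| ≤ K) →
      (∀ᵐ y ∂(volume.restrict Ω), ContinuousWithinAt k Ω y) →
      Tendsto (fun n => (∏ j, (b j - a j) / N n j) *
        ∑ i : {i : ∀ j, Fin (N n j) // x n i ∈ Ω}, k (x n i.1)) atTop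
        (nhds (∫ y in Ω, k y)) := by
    intro k K hK hk
    have h := tendsto_riemannSum hab N hN x hau (ae_continuousAt_indicator hΩreg hk)
      (C := max K 0) (fun y => by
        by_cases hy : y ∈ Ω
        · rw [Set.indicator_of_mem hy]
          exact (hK y hy).trans (le_max_left _ _)
        · rw [Set.indicator_of_notMem hy, abs_zero]
          exact le_max_right _ _)
      (fun y hy => Set.indicator_of_notMem (fun h => hy (hΩab h)) _)
    rw [integral_indicator₀ hnull] at h
    refine h.congr fun n => ?_
    congr 1
    simp only [Set.indicator_apply]
    rw [← Finset.sum_filter]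
    exact (Finset.sum_subtype _ (by simp) (fun i => k (x n i)))
  have hfin : volume Ω ≠ ⊤ := ((measure_mono hΩab).trans_lt
    isCompact_Icc.measure_lt_top).ne
  have hone := main (fun _ => 1) 1 (by simp) (.of_forall fun _ => continuousWithinAt_const)
  have hvol : ∫ _y in Ω, (1 : ℝ) = (volume Ω).toReal := by simp [Measure.real]
  rw [hvol] at hone
  have hdiv := (main g C hgC hgcont).div hone (ENNReal.toReal_pos hΩpos.ne' hfin).ne'
  rw [div_eq_inv_mul (∫ y in Ω, g y)] at hdiv
  refine hdiv.congr' ?_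
  filter_upwards [eventually_all.2 fun j => (hN j).eventually_gt_atTop 0] with n hn
  have hp : ∏ j, (b j - a j) / N n j ≠ 0 := (Finset.prod_pos fun j _ =>
    div_pos (sub_pos.2 (hab j)) (Nat.cast_pos.2 (hn j))).ne'
  rw [Pi.div_apply, mul_div_mul_left _ _ hp, div_eq_inv_mul]
  simp

/-- A continuous function agrees on a compact interval with a compactly supported continuous
function. -/
lemma exists_compactSupport_eqOn_Icc {φ : ℝ → ℝ} (hφ : Continuous φ) (A B : ℝ) :
    ∃ ψ : ℝ → ℝ, Continuous ψ ∧ HasCompactSupport ψ ∧ Set.EqOn ψ φ (Set.Icc A B) := by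
  obtain ⟨χ, h1, -, hχ, -⟩ := exists_continuous_one_zero_of_isCompact
    (isCompact_Icc (a := A) (b := B)) isClosed_empty (Set.disjoint_empty _)
  refine ⟨fun y => χ y * φ y, χ.continuous.mul hφ, hχ.mul_right, fun y hy => ?_⟩
  simp [h1 hy]

lemma tendsto_average_of_continuous {d : ℕ} {Ω : Set (Fin d → ℝ)}
    (hnull : NullMeasurableSet Ω volume) {f : (Fin d → ℝ) → ℝ} {A B : ℝ}
    (hf : ∀ y ∈ Ω, f y ∈ Set.Icc A B) {ι : ℕ → Type} [∀ n, Fintype (ι n)]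
    (lam : ∀ n, ι n → ℝ)
    (hdistr : ∀ F : ℝ → ℂ, Continuous F → HasCompactSupport F →
      Tendsto (fun n => (Fintype.card (ι n) : ℂ)⁻¹ * ∑ i, F (lam n i))
        atTop (nhds (((volume Ω).toReal)⁻¹ • ∫ y in Ω, F (f y))))
    {ε : ℕ → ℝ} (hε : Tendsto ε atTop (nhds 0))
    (hlam : ∀ n i, lam n i ∈ Set.Icc (A - ε n) (B + ε n))
    {φ : ℝ → ℝ} (hφ : Continuous φ) :
    Tendsto (fun n => (Fintype.card (ι n) : ℝ)⁻¹ * ∑ i, φ (lam n i)) atTop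
      (nhds ((volume Ω).toReal⁻¹ * ∫ y in Ω, φ (f y))) := by
  obtain ⟨ψ, hψ, hψc, heq⟩ := exists_compactSupport_eqOn_Icc hφ (A - 1) (B + 1)
  have h := (Complex.continuous_re.tendsto _).comp (hdistr (fun y => (ψ y : ℂ))
    (Complex.continuous_ofReal.comp hψ) (hψc.comp_left Complex.ofReal_zero))
  have hint : ∫ y in Ω, φ (f y) = ∫ y in Ω, ψ (f y) := by
    refine integral_congr_ae ((ae_restrict_iff'₀ hnull).2 (.of_forall fun y hy => ?_))
    have := hf y hy
    exact (heq ⟨by linarith [this.1], by linarith [this.2]⟩).symm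
  rw [integral_complex_ofReal, Complex.smul_re, Complex.ofReal_re, smul_eq_mul, ← hint] at h
  refine h.congr' ?_
  filter_upwards [hε.eventually_le_const one_pos] with n hn
  have hsum : ∑ i, φ (lam n i) = ∑ i, ψ (lam n i) := by
    refine Finset.sum_congr rfl fun i _ => ?_
    have := hlam n i
    exact (heq ⟨by linarith [this.1], by linarith [this.2]⟩).symm
  rw [hsum, Function.comp_apply, ← Complex.ofReal_natCast, ← Complex.ofReal_inv,
    Complex.re_ofReal_mul, ← Complex.ofReal_sum, Complex.ofReal_re]

/-- (Theorem `th:main4-n`.) Let `f : Ω ⊂ ℝ^d → ℝ` be bounded and continuous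
a.e. on a regular set `Ω` with `μ_d(Ω) > 0` and essential range `[inf_Ω f, sup_Ω f]`. Take a
rectangle `[a,b] ⊇ Ω`, multi-index sizes `𝐧(n) → ∞`, and an a.u. grid `{x_{𝐢,𝐧}}` in `[a,b]`.
Given real numbers `λ_{𝐢,𝐧}` indexed over `I_𝐧(Ω) = {𝐢 : x_{𝐢,𝐧} ∈ Ω}` whose multisets
distribute as `f` and lie in `[inf_Ω f − ε_n, sup_Ω f + ε_n]` with `ε_n → 0`, for any
enumerations `σ_n, τ_n` of `I_𝐧(Ω)` sorting the samples `f(x_{𝐢,𝐧})` and the values `λ_{𝐢,𝐧}`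
in increasing order, the maximum of `|f(x_{σ_n(𝐢),𝐧}) − λ_{τ_n(𝐢),𝐧}|` tends to `0`. -/
theorem stmt_0
    (d : ℕ) (hd : 0 < d)
    (Ω : Set (Fin d → ℝ))
    (hΩbdd : Bornology.IsBounded Ω)
    (hΩreg : volume (frontier Ω) = 0)
    (hΩpos : 0 < volume Ω)
    (f : (Fin d → ℝ) → ℝ)
    (hfbdd : ∃ C : ℝ, ∀ x ∈ Ω, |f x| ≤ C)
    (hfcont : ∀ᵐ x ∂(volume.restrict Ω), ContinuousWithinAt f Ω x)
    (hER : {z : ℝ | ∀ ε : ℝ, 0 < ε → 0 < volume {x ∈ Ω | |f x - z| < ε}}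
      = Set.Icc (sInf (f '' Ω)) (sSup (f '' Ω)))
    (a b : Fin d → ℝ) (hΩab : Ω ⊆ Set.Icc a b)
    (N : ℕ → Fin d → ℕ) (hN : ∀ j, Tendsto (fun n => N n j) atTop atTop)
    (x : ∀ n, (∀ j, Fin (N n j)) → (Fin d → ℝ))
    (hau : Tendsto (fun n => ⨆ i : ∀ j, Fin (N n j), ⨆ j : Fin d,
        |x n i j - (a j + (((i j : ℕ) : ℝ) + 1) * (b j - a j) / (N n j : ℝ))|)
      atTop (nhds 0))
    (lam : ∀ n, {i : ∀ j, Fin (N n j) // x n i ∈ Ω} → ℝ)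
    (hdistr : ∀ F : ℝ → ℂ, Continuous F → HasCompactSupport F →
      Tendsto (fun n => (Fintype.card {i : ∀ j, Fin (N n j) // x n i ∈ Ω} : ℂ)⁻¹ *
          ∑ i : {i : ∀ j, Fin (N n j) // x n i ∈ Ω}, F (lam n i))
        atTop (nhds (((volume Ω).toReal)⁻¹ • ∫ y in Ω, F (f y))))
    (ε : ℕ → ℝ) (hε : Tendsto ε atTop (nhds 0))
    (hlam : ∀ n i, lam n i ∈ Set.Icc (sInf (f '' Ω) - ε n) (sSup (f '' Ω) + ε n))
    (σ τ : ∀ n, Fin (Fintype.card {i : ∀ j, Fin (N n j) // x n i ∈ Ω})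
      ≃ {i : ∀ j, Fin (N n j) // x n i ∈ Ω})
    (hσ : ∀ n, Monotone fun m => f (x n (σ n m).1))
    (hτ : ∀ n, Monotone fun m => lam n (τ n m)) :
    Tendsto (fun n => ⨆ m : Fin (Fintype.card {i : ∀ j, Fin (N n j) // x n i ∈ Ω}),
        |f (x n (σ n m).1) - lam n (τ n m)|) atTop (nhds 0) := by
  obtain ⟨C, hC⟩ := hfbdd
  have hnull := nullMeasurableSet_of_null_frontier hΩreg
  have hfin : volume Ω ≠ ⊤ := hΩbdd.measure_lt_top.ne
  have hab : ∀ j, a j < b j := by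
    intro j
    by_contra! hj
    refine hΩpos.ne' (measure_mono_null hΩab ?_)
    rw [Real.volume_Icc_pi]
    exact Finset.prod_eq_zero (Finset.mem_univ j) (ENNReal.ofReal_eq_zero.2 (sub_nonpos.2 hj))
  have hbelow : BddBelow (f '' Ω) := ⟨-C, by
    rintro _ ⟨y, hy, rfl⟩
    exact (abs_le.1 (hC y hy)).1⟩
  have habove : BddAbove (f '' Ω) := ⟨C, by
    rintro _ ⟨y, hy, rfl⟩
    exact (abs_le.1 (hC y hy)).2⟩
  have hfAB : ∀ y ∈ Ω, f y ∈ Set.Icc (sInf (f '' Ω)) (sSup (f '' Ω)) := fun y hy =>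
    ⟨csInf_le hbelow ⟨y, hy, rfl⟩, le_csSup habove ⟨y, hy, rfl⟩⟩
  set A := sInf (f '' Ω)
  set B := sSup (f '' Ω)
  have hfmeas : AEMeasurable f (volume.restrict Ω) :=
    ((aestronglyMeasurable_of_ae_continuousAt
      (ae_continuousAt_indicator hΩreg hfcont)).restrict.congr
        ((ae_restrict_iff'₀ hnull).2 (.of_forall fun y hy =>
          Set.indicator_of_mem hy f))).aemeasurable
  have : IsFiniteMeasure (volume.restrict Ω) := isFiniteMeasure_restrict.2 hfin
  set ν := Measure.map f (volume.restrict Ω) with hνdef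
  have hν : ∀ z ∈ Set.Icc A B, ∀ r > 0, 0 < ν (Metric.ball z r) := by
    intro z hz r hr
    rw [← hER] at hz
    rw [hνdef, Measure.map_apply_of_aemeasurable hfmeas measurableSet_ball]
    refine (hz r hr).trans_le (le_trans (measure_mono ?_) (Measure.le_restrict_apply _ _))
    rintro y ⟨hy, hyr⟩
    exact ⟨by rwa [Set.mem_preimage, Metric.mem_ball, Real.dist_eq], hy⟩
  have hintν : ∀ φ : ℝ → ℝ, Continuous φ → ∫ y, φ y ∂ν = ∫ y in Ω, φ (f y) := fun φ hφ =>
    integral_map hfmeas hφ.aestronglyMeasurable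
  have hc : 0 < (volume Ω).toReal⁻¹ := inv_pos.2 (ENNReal.toReal_pos hΩpos.ne' hfin)
  have hud : ∀ φ : ℝ → ℝ, Continuous φ →
      Tendsto (fun n => (Fintype.card {i : ∀ j, Fin (N n j) // x n i ∈ Ω} : ℝ)⁻¹ *
        ∑ m, φ (f (x n (σ n m).1))) atTop (nhds ((volume Ω).toReal⁻¹ * ∫ y, φ y ∂ν)) := by
    intro φ hφ
    obtain ⟨K, hK⟩ := (isCompact_Icc (a := A) (b := B)).exists_bound_of_continuousOn
      hφ.continuousOn
    rw [hintν φ hφ]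
    refine (tendsto_average_samples hΩreg hΩpos hab hΩab (g := fun y => φ (f y))
      (fun y hy => hK _ (hfAB y hy)) ?_ N hN x hau).congr fun n => ?_
    · filter_upwards [hfcont] with y hy using hφ.continuousAt.comp_continuousWithinAt hy
    · rw [← (σ n).sum_comp]
  have hvd : ∀ φ : ℝ → ℝ, Continuous φ →
      Tendsto (fun n => (Fintype.card {i : ∀ j, Fin (N n j) // x n i ∈ Ω} : ℝ)⁻¹ *
        ∑ m, φ (lam n (τ n m))) atTop (nhds ((volume Ω).toReal⁻¹ * ∫ y, φ y ∂ν)) := by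
    intro φ hφ
    rw [hintν φ hφ]
    refine (tendsto_average_of_continuous hnull hfAB lam hdistr hε hlam hφ).congr fun n => ?_
    rw [← (τ n).sum_comp]
  have hεabs : Tendsto (fun n => |ε n|) atTop (nhds 0) := by simpa using hε.abs
  have hub : ∀ n m, A - |ε n| ≤ f (x n (σ n m).1) ∧ f (x n (σ n m).1) ≤ B + |ε n| := by
    intro n m
    have h := hfAB _ (σ n m).2
    constructor <;> linarith [h.1, h.2, abs_nonneg (ε n)]
  have hvb : ∀ n m, A - |ε n| ≤ lam n (τ n m) ∧ lam n (τ n m) ≤ B + |ε n| := by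
    intro n m
    have h := hlam n (τ n m)
    constructor <;> linarith [h.1, h.2, le_abs_self (ε n)]
  rw [Metric.tendsto_nhds]
  intro δ hδ
  filter_upwards [eventually_le_add_of_same_distribution ν hc hν _ _ _ hσ hτ hud hvd hεabs
      (fun n m => (hub n m).2) (fun n m => (hvb n m).1) (half_pos hδ),
    eventually_le_add_of_same_distribution ν hc hν _ _ _ hτ hσ hvd hud hεabs
      (fun n m => (hvb n m).2) (fun n m => (hub n m).1) (half_pos hδ)] with n h1 h2
  rw [Real.dist_0_eq_abs, abs_of_nonneg (Real.iSup_nonneg fun _ => abs_nonneg _)]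
  refine (Real.iSup_le (fun m => ?_) (half_pos hδ).le).trans_lt (half_lt_self hδ)
  rw [abs_le]
  constructor <;> linarith [h1 m, h2 m]
end

section
/- Let f : [a,b] → ℝ be bounded with a finite number of local maximum points, a finite number of local minimum points, and a finite number of discontinuity points, and with ER(f) = [inf_{[a,b]} f, sup_{[a,b]} f]. Let {Λ_n = {λ_{1,n},…,λ_{d_n,n}}}_n be a sequence of finite multisets of real numbers with d_n → ∞, and assume (i) {Λ_n}_n ∼ f and (ii) Λ_n ⊆ f([a,b]) for every n. Then there exist an asymptotically uniform grid {x_{i,n}}_{i=1,…,d_n} in [a,b] with all points contained in [a,b], and for every n a permutation τ_n of {1,…,d_n}, such that λ_{τ_n(i),n} = f(x_{i,n}) for all i = 1,…,d_n and all n. -/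
open MeasureTheory Filter

/-- Upper bound of the portmanteau theorem for the empirical measures of finite families. -/
theorem eventually_card_mul_le_measureReal {ν : Measure ℝ} [IsFiniteMeasure ν] {L : ℝ} (hL : 0 < L)
    {dn : ℕ → ℕ} {lam : ∀ n, Fin (dn n) → ℝ}
    (h : ∀ F : ℝ → ℂ, Continuous F → HasCompactSupport F →
      Tendsto (fun n => (dn n : ℂ)⁻¹ * ∑ i : Fin (dn n), F (lam n i)) atTop
        (nhds (L⁻¹ • ∫ z, F z ∂ν)))
    {K : Set ℝ} (hK : IsCompact K) {η : ℝ} (hη : 0 < η) :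
    ∀ᶠ n in atTop, (Nat.card {i // lam n i ∈ K} : ℝ) * (L / dn n) ≤ ν.real K + η := by
  classical
  obtain ⟨U, hKU, hU, hνU⟩ := hK.exists_isOpen_lt_add (μ := ν) (ε := ENNReal.ofReal η)
    (by simpa using hη)
  have hνU' : ν.real U < ν.real K + η := by
    have := (ENNReal.toReal_lt_toReal (measure_ne_top ν U)
      (ENNReal.add_ne_top.2 ⟨measure_ne_top ν K, ENNReal.ofReal_ne_top⟩)).2 hνU
    rwa [ENNReal.toReal_add (measure_ne_top ν K) ENNReal.ofReal_ne_top,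
      ENNReal.toReal_ofReal hη.le] at this
  obtain ⟨φ, hφ1, hφ0, hφc, hφ⟩ := exists_continuous_one_zero_of_isCompact hK hU.isClosed_compl
    (Set.disjoint_compl_right_iff_subset.2 hKU)
  have hint : ∫ z, φ z ∂ν ≤ ν.real U := by
    rw [← integral_indicator_one hU.measurableSet]
    refine integral_mono (φ.continuous.integrable_of_hasCompactSupport hφc)
      ((integrable_const (1 : ℝ)).indicator hU.measurableSet) fun z => ?_
    by_cases hz : z ∈ U
    · simpa [hz] using (hφ z).2
    · simpa [hz] using (hφ0 hz).le
  have hlim : Tendsto (fun n => (dn n : ℝ)⁻¹ * ∑ i : Fin (dn n), φ (lam n i)) atTop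
      (nhds (L⁻¹ * ∫ z, φ z ∂ν)) := by
    have := h (fun z => (φ z : ℂ)) (by fun_prop)
      (hφc.comp_left (g := fun t : ℝ => (t : ℂ)) Complex.ofReal_zero)
    rw [integral_complex_ofReal] at this
    have := (Complex.continuous_re.tendsto _).comp this
    refine (this.congr fun n => ?_).trans (le_of_eq ?_)
    · simp only [Function.comp_apply]
      rw [← Complex.ofReal_re ((dn n : ℝ)⁻¹ * ∑ i : Fin (dn n), φ (lam n i))]
      push_cast
      rfl
    · simp
  have hlt : L⁻¹ * ∫ z, φ z ∂ν < L⁻¹ * (ν.real K + η) :=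
    mul_lt_mul_of_pos_left (hint.trans_lt hνU') (inv_pos.2 hL)
  filter_upwards [hlim.eventually_lt_const hlt] with n hn
  have hcard : (Nat.card {i // lam n i ∈ K} : ℝ) ≤ ∑ i : Fin (dn n), φ (lam n i) := by
    rw [Nat.card_eq_fintype_card, Fintype.card_subtype, Finset.card_filter]
    push_cast
    refine Finset.sum_le_sum fun i _ => ?_
    split_ifs with hi
    · exact (hφ1 hi).ge
    · exact (hφ _).1
  calc (Nat.card {i // lam n i ∈ K} : ℝ) * (L / dn n)
      ≤ (∑ i : Fin (dn n), φ (lam n i)) * (L / dn n) := by gcongr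
    _ = L * ((dn n : ℝ)⁻¹ * ∑ i : Fin (dn n), φ (lam n i)) := by ring
    _ ≤ L * (L⁻¹ * (ν.real K + η)) := by gcongr
    _ = ν.real K + η := by field_simp

/-- Two points lie in the same cell of the decomposition of the line induced by `Y` when they have
the same position relative to every point of `Y`. -/
noncomputable def cell (Y : Set ℝ) (u : ℝ) : Y → SignType := fun y => SignType.sign (u - y)

theorem cell_eq_lt_iff {Y : Set ℝ} {u v y : ℝ} (h : cell Y u = cell Y v) (hy : y ∈ Y) :
    (u < y ↔ v < y) ∧ (y < u ↔ y < v) := by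
  have := congrFun h ⟨y, hy⟩
  simp only [cell] at this
  constructor
  · rw [← sub_neg, ← sign_eq_neg_one_iff, this, sign_eq_neg_one_iff, sub_neg]
  · rw [← sub_pos, ← sign_eq_one_iff, this, sign_eq_one_iff, sub_pos]

theorem closure_preimage_cell_subset {Y : Set ℝ} (hY : Y.Finite) (C : Set (Y → SignType)) :
    closure (cell Y ⁻¹' C) ⊆ cell Y ⁻¹' C ∪ Y := by
  intro u hu
  by_cases huY : u ∈ Y
  · exact Or.inr huY
  left
  have := hY.to_subtype
  have hloc : ∀ᶠ v in nhds u, cell Y v = cell Y u := by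
    have : ∀ y : Y, ∀ᶠ v in nhds u, cell Y v y = cell Y u y := by
      intro y
      rcases lt_or_gt_of_ne (fun h => huY (h ▸ y.2) : u ≠ y) with h | h
      · filter_upwards [Iio_mem_nhds h] with v hv
        simp only [cell]
        rw [sign_neg (sub_neg.2 h), sign_neg (sub_neg.2 hv)]
      · filter_upwards [Ioi_mem_nhds h] with v hv
        simp only [cell]
        rw [sign_pos (sub_pos.2 h), sign_pos (sub_pos.2 hv)]
    filter_upwards [eventually_all.2 this] with v hv
    exact funext hv
  obtain ⟨v, hv, hvC⟩ := mem_closure_iff_nhds.1 hu _ hloc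
  have hv' : cell Y v = cell Y u := hv
  simpa [Set.mem_preimage, hv'] using hvC

theorem exists_gap {T : Set ℝ} (hT : T.Finite) {a b x : ℝ} (ha : a ∈ T) (hb : b ∈ T)
    (hx : x ∈ Set.Icc a b) (hxT : x ∉ T) :
    ∃ s ∈ T, ∃ t ∈ T, x ∈ Set.Ioo s t ∧ Disjoint (Set.Ioo s t) T ∧ Set.Ioo s t ⊆ Set.Icc a b := by
  have hax : a < x := lt_of_le_of_ne hx.1 fun h => hxT (h ▸ ha)
  have hxb : x < b := lt_of_le_of_ne hx.2 fun h => hxT (h ▸ hb)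
  obtain ⟨s, ⟨hsT, hsx⟩, hs⟩ := Set.exists_max_image (T ∩ Set.Iio x) id
    (hT.subset Set.inter_subset_left) ⟨a, ha, hax⟩
  obtain ⟨t, ⟨htT, hxt⟩, ht⟩ := Set.exists_min_image (T ∩ Set.Ioi x) id
    (hT.subset Set.inter_subset_left) ⟨b, hb, hxb⟩
  refine ⟨s, hsT, t, htT, ⟨hsx, hxt⟩, Set.disjoint_left.2 fun y hy hyT => ?_,
    fun y hy => ⟨(hs a ⟨ha, hax⟩).trans hy.1.le, hy.2.le.trans (ht b ⟨hb, hxb⟩)⟩⟩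
  rcases lt_trichotomy y x with h | h | h
  · exact (hs y ⟨hyT, h⟩).not_gt hy.1
  · exact hxT (h ▸ hyT)
  · exact (ht y ⟨hyT, h⟩).not_gt hy.2

/-- Level sets are finite when local extrema and discontinuities are finite in number. -/
theorem finite_levelSet {a b : ℝ} {f : ℝ → ℝ}
    (hmax : {x ∈ Set.Icc a b | IsLocalMaxOn f (Set.Icc a b) x}.Finite)
    (hmin : {x ∈ Set.Icc a b | IsLocalMinOn f (Set.Icc a b) x}.Finite)
    (hdisc : {x ∈ Set.Icc a b | ¬ ContinuousWithinAt f (Set.Icc a b) x}.Finite) (y : ℝ) :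
    {x ∈ Set.Icc a b | f x = y}.Finite := by
  obtain ⟨T, hT, haT, hbT, hmaxT, hminT, hdiscT⟩ : ∃ T : Set ℝ, T.Finite ∧ a ∈ T ∧ b ∈ T ∧
      {x ∈ Set.Icc a b | IsLocalMaxOn f (Set.Icc a b) x} ⊆ T ∧
      {x ∈ Set.Icc a b | IsLocalMinOn f (Set.Icc a b) x} ⊆ T ∧
      {x ∈ Set.Icc a b | ¬ ContinuousWithinAt f (Set.Icc a b) x} ⊆ T :=
    ⟨_, (((hmax.union hmin).union hdisc).insert b).insert a, by grind, by grind, by grind,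
      by grind, by grind⟩
  let G : ℝ × ℝ → Set ℝ := fun p => {x | x ∈ Set.Ioo p.1 p.2 ∧ f x = y ∧
    Disjoint (Set.Ioo p.1 p.2) T ∧ Set.Ioo p.1 p.2 ⊆ Set.Icc a b}
  have hG : ∀ p, (G p).Subsingleton := by
    have key : ∀ p, ∀ u ∈ G p, ∀ v ∈ G p, ¬ u < v := by
      rintro p u ⟨hu, huy, hdisj, hsub⟩ v ⟨hv, hvy, -, -⟩ huv
      have hIcc : Set.Icc u v ⊆ Set.Ioo p.1 p.2 := Set.Icc_subset_Ioo hu.1 hv.2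
      have hcont : ContinuousOn f (Set.Icc u v) := fun w hw => by
        by_contra hw'
        refine Set.disjoint_left.1 hdisj (hIcc hw) (hdiscT ⟨hsub (hIcc hw), fun h => hw' ?_⟩)
        exact h.mono (hIcc.trans hsub)
      obtain ⟨c, hc, hext⟩ := exists_isLocalExtr_Ioo huv hcont (huy.trans hvy.symm)
      have hc' := hIcc (Set.Ioo_subset_Icc_self hc)
      rcases hext with h | h
      · exact Set.disjoint_left.1 hdisj hc' (hminT ⟨hsub hc', IsLocalMin.on h _⟩)
      · exact Set.disjoint_left.1 hdisj hc' (hmaxT ⟨hsub hc', IsLocalMax.on h _⟩)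
    exact fun p u hu v hv => le_antisymm (not_lt.1 (key p v hv u hu)) (not_lt.1 (key p u hu v hv))
  refine (hT.union ((hT.prod hT).biUnion fun p _ => (hG p).finite)).subset ?_
  rintro x ⟨hx, hxy⟩
  by_cases hxT : x ∈ T
  · exact Or.inl hxT
  obtain ⟨s, hs, t, ht, hxst, hdisj, hsub⟩ := exists_gap hT haT hbT hx hxT
  exact Or.inr (Set.mem_biUnion (x := (s, t)) ⟨hs, ht⟩ ⟨hxst, hxy, hdisj, hsub⟩)

/-- For a bounded function with finitely many discontinuities, the line can be cut at finitely many
points so that any two attained values in a common cell have nearby preimages. -/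
theorem exists_finite_cell_lift {a b : ℝ} {f : ℝ → ℝ}
    (hfbdd : ∃ C : ℝ, ∀ x ∈ Set.Icc a b, |f x| ≤ C)
    (hdisc : {x ∈ Set.Icc a b | ¬ ContinuousWithinAt f (Set.Icc a b) x}.Finite)
    {ε : ℝ} (hε : 0 < ε) :
    ∃ Y : Set ℝ, Y.Finite ∧ ∀ x ∈ Set.Icc a b, ∀ z, cell Y (f x) = cell Y z →
      ∃ x' ∈ Set.Icc a b, f x' = z ∧ |x - x'| < ε := by
  obtain ⟨N, -, hN, hcov⟩ := (isCompact_Icc (a := a) (b := b)).finite_cover_balls (half_pos hε)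
  obtain ⟨T, hT, haT, hbT, hNT, hdiscT⟩ : ∃ T : Set ℝ, T.Finite ∧ a ∈ T ∧ b ∈ T ∧ N ⊆ T ∧
      {x ∈ Set.Icc a b | ¬ ContinuousWithinAt f (Set.Icc a b) x} ⊆ T :=
    ⟨_, ((hN.union hdisc).insert b).insert a, by grind, by grind, by grind, by grind⟩
  let Y : Set ℝ := f '' T ∪ ((fun p : ℝ × ℝ => sInf (f '' Set.Ioo p.1 p.2)) '' (T ×ˢ T) ∪
    (fun p : ℝ × ℝ => sSup (f '' Set.Ioo p.1 p.2)) '' (T ×ˢ T))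
  refine ⟨Y, (hT.image _).union (((hT.prod hT).image _).union ((hT.prod hT).image _)), ?_⟩
  intro x hx z hz
  by_cases hxY : f x ∈ Y
  · obtain ⟨h1, h2⟩ := cell_eq_lt_iff hz hxY
    exact ⟨x, hx, le_antisymm (not_lt.1 fun h => lt_irrefl _ (h1.2 (by grind)))
      (by grind), by simpa using hε⟩
  obtain ⟨s, hs, t, ht, hxst, hdisj, hsub⟩ := exists_gap hT haT hbT hx
    fun h => hxY (Or.inl ⟨x, h, rfl⟩)
  have hlen : t - s < ε := by
    have hst : s < t := hxst.1.trans hxst.2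
    have hmid : (s + t) / 2 ∈ Set.Ioo s t := ⟨by linarith, by linarith⟩
    obtain ⟨c, hc, hcm⟩ := Set.mem_iUnion₂.1 (hcov (hsub hmid))
    have hcI : c ∉ Set.Ioo s t := fun h => Set.disjoint_left.1 hdisj h (hNT hc)
    rw [Metric.mem_ball, Real.dist_eq, abs_lt] at hcm
    by_contra! hcon
    exact hcI ⟨by linarith, by linarith⟩
  have hcont : ContinuousOn f (Set.Ioo s t) := fun w hw => by
    by_contra hw'
    exact Set.disjoint_left.1 hdisj hw (hdiscT ⟨hsub hw, fun h => hw' (h.mono hsub)⟩)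
  obtain ⟨C, hC⟩ := hfbdd
  have hbelow : BddBelow (f '' Set.Ioo s t) := ⟨-C, by
    rintro _ ⟨w, hw, rfl⟩
    exact (abs_le.1 (hC w (hsub hw))).1⟩
  have habove : BddAbove (f '' Set.Ioo s t) := ⟨C, by
    rintro _ ⟨w, hw, rfl⟩
    exact (abs_le.1 (hC w (hsub hw))).2⟩
  have hne : (f '' Set.Ioo s t).Nonempty := ⟨f x, x, hxst, rfl⟩
  have hinfY : sInf (f '' Set.Ioo s t) ∈ Y := Or.inr (Or.inl ⟨(s, t), ⟨hs, ht⟩, rfl⟩)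
  have hsupY : sSup (f '' Set.Ioo s t) ∈ Y := Or.inr (Or.inr ⟨(s, t), ⟨hs, ht⟩, rfl⟩)
  have hinf : sInf (f '' Set.Ioo s t) < z := (cell_eq_lt_iff hz hinfY).2.1 <|
    lt_of_le_of_ne (csInf_le hbelow ⟨x, hxst, rfl⟩) fun h => hxY (h ▸ hinfY)
  have hsup : z < sSup (f '' Set.Ioo s t) := (cell_eq_lt_iff hz hsupY).1.1 <|
    lt_of_le_of_ne (le_csSup habove ⟨x, hxst, rfl⟩) fun h => hxY (h ▸ hsupY)
  obtain ⟨_, ⟨u, hu, rfl⟩, huz⟩ := exists_lt_of_csInf_lt hne hinf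
  obtain ⟨_, ⟨v, hv, rfl⟩, hzv⟩ := exists_lt_of_lt_csSup hne hsup
  obtain ⟨x', hx', rfl⟩ := isPreconnected_Ioo.intermediate_value hu hv hcont ⟨huz.le, hzv.le⟩
  exact ⟨x', hsub hx', rfl, abs_lt.2 ⟨by linarith [hxst.1, hx'.2], by linarith [hxst.2, hx'.1]⟩⟩

theorem aemeasurable_of_finite_discontinuities {a b : ℝ} {f : ℝ → ℝ}
    (hdisc : {x ∈ Set.Icc a b | ¬ ContinuousWithinAt f (Set.Icc a b) x}.Finite) :
    AEMeasurable f (volume.restrict (Set.Icc a b)) := by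
  set D := {x ∈ Set.Icc a b | ¬ ContinuousWithinAt f (Set.Icc a b) x}
  have h : AEMeasurable f (volume.restrict (Set.Icc a b \ D)) := by
    refine ContinuousOn.aemeasurable (fun x hx => ?_) (measurableSet_Icc.diff hdisc.measurableSet)
    by_contra h
    exact hx.2 ⟨hx.1, fun h' => h (h'.mono Set.sdiff_subset)⟩
  rwa [Measure.restrict_congr_set (sdiff_null_ae_eq_self (hdisc.measure_zero _))] at h

/-- Enlarging a nonempty subset of `[a, b]` by `η` increases its measure by at least `η`, unless
the enlargement covers `[a, b]`. -/
theorem measureReal_add_le_measureReal_enlargement {a b η : ℝ} (hη : 0 < η) {P : Set ℝ}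
    (hP : P ⊆ Set.Icc a b) (hne : P.Nonempty) {g : ℝ} (hg : g ∈ Set.Icc a b)
    (hfar : ∀ x ∈ P, η ≤ |x - g|) :
    volume.real P + η ≤ volume.real {y ∈ Set.Icc a b | ∃ x ∈ P, |x - y| < η} := by
  set M := {y ∈ Set.Icc a b | ∃ x ∈ P, |x - y| < η}
  have hfin : ∀ {s : Set ℝ}, s ⊆ Set.Icc a b → volume s ≠ ⊤ := fun hs =>
    measure_ne_top_of_subset hs measure_Icc_lt_top.ne
  have hPM : P ⊆ M := fun x hx => ⟨hP hx, x, hx, by simpa using hη⟩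
  have hMI : M ⊆ Set.Icc a b := fun y hy => hy.1
  suffices ∃ c, Set.Ioo c (c + η) ⊆ M ∧ Disjoint P (Set.Ioo c (c + η)) by
    obtain ⟨c, hcM, hdisj⟩ := this
    calc volume.real P + η = volume.real (P ∪ Set.Ioo c (c + η)) := by
          rw [measureReal_union hdisj measurableSet_Ioo (hfin hP) (hfin (hcM.trans hMI)),
            Real.volume_real_Ioo_of_le (by linarith)]
          ring
      _ ≤ volume.real M := measureReal_mono (Set.union_subset hPM hcM) (hfin hMI)
  obtain ⟨p, hp⟩ := hne
  rcases le_total p g with hpg | hpg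
  · have hneg : (P ∩ Set.Iic g).Nonempty := ⟨p, hp, hpg⟩
    have hub : ∀ x ∈ P ∩ Set.Iic g, x ≤ g - η := fun x hx => by
      have h1 := hfar x hx.1
      rw [abs_of_nonpos (sub_nonpos.2 hx.2)] at h1
      linarith
    have hbdd : BddAbove (P ∩ Set.Iic g) := ⟨g - η, hub⟩
    have hsup := csSup_le hneg hub
    refine ⟨sSup (P ∩ Set.Iic g), fun q hq => ?_, Set.disjoint_left.2 fun q hqP hq => ?_⟩
    · obtain ⟨p', hp', hqp'⟩ := exists_lt_of_lt_csSup hneg (show q - η < _ by linarith [hq.2])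
      have hle := le_csSup hbdd hp'
      have := hP hp'.1
      exact ⟨⟨by linarith [this.1, hq.1], by linarith [hg.2, hq.2]⟩, p', hp'.1,
        abs_lt.2 ⟨by linarith, by linarith [hq.1]⟩⟩
    · exact hq.1.not_ge (le_csSup hbdd ⟨hqP, by simp only [Set.mem_Iic]; linarith [hq.2]⟩)
  · have hneg : (P ∩ Set.Ici g).Nonempty := ⟨p, hp, hpg⟩
    have hlb : ∀ x ∈ P ∩ Set.Ici g, g + η ≤ x := fun x hx => by
      have h1 := hfar x hx.1
      rw [abs_of_nonneg (sub_nonneg.2 hx.2)] at h1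
      linarith
    have hbdd : BddBelow (P ∩ Set.Ici g) := ⟨g + η, hlb⟩
    have hinf := le_csInf hneg hlb
    refine ⟨sInf (P ∩ Set.Ici g) - η, fun q hq => ?_, Set.disjoint_left.2 fun q hqP hq => ?_⟩
    · obtain ⟨p', hp', hqp'⟩ := exists_lt_of_csInf_lt hneg (show _ < q + η by linarith [hq.1])
      have hle := csInf_le hbdd hp'
      have := hP hp'.1
      exact ⟨⟨by linarith [hg.1, hq.1], by linarith [this.2, hq.2]⟩, p', hp'.1,
        abs_lt.2 ⟨by linarith [hq.2], by linarith⟩⟩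
    · linarith [hq.2, csInf_le hbdd ⟨hqP, show g ≤ q by linarith [hq.1]⟩]

/-- The measure of a subset of `[a, b]` is at most the step size of a uniform grid times the number
of grid points within one step of it. -/
theorem measureReal_le_card_mul {a b : ℝ} (hab : a < b) {d : ℕ} (hd : 0 < d) {M : Set ℝ}
    (hM : M ⊆ Set.Icc a b) :
    volume.real M ≤ (Nat.card {j : Fin d // ∃ y ∈ M,
      |y - (a + (((j : ℕ) : ℝ) + 1) * (b - a) / d)| ≤ (b - a) / d} : ℝ) * ((b - a) / d) := by
  classical
  have hd' : (0 : ℝ) < d := by exact_mod_cast hd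
  set h := (b - a) / d with hh
  have hpos : 0 < h := div_pos (sub_pos.2 hab) hd'
  have hdh : d * h = b - a := by rw [hh]; field_simp
  let g : Fin d → ℝ := fun j => a + (((j : ℕ) : ℝ) + 1) * (b - a) / d
  have hg : ∀ j, g j = a + ((j : ℕ) + 1) * h := fun j => by simp only [g, hh]; ring
  let J : Finset (Fin d) := Finset.univ.filter fun j => ∃ y ∈ M, |y - g j| ≤ h
  have hcover : M ⊆ {a} ∪ ⋃ j ∈ J, Set.Ioc (g j - h) (g j) := by
    intro y hy
    rcases (hM hy).1.eq_or_lt with hya | hya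
    · exact Or.inl hya.symm
    have hq : 0 < (y - a) / h := div_pos (sub_pos.2 hya) hpos
    have hk0 : 0 < ⌈(y - a) / h⌉₊ := Nat.ceil_pos.2 hq
    obtain ⟨k, hk⟩ : ∃ k, ⌈(y - a) / h⌉₊ = k + 1 := ⟨_, (Nat.succ_pred_eq_of_pos hk0).symm⟩
    have hkd : k < d := by
      have : ⌈(y - a) / h⌉₊ ≤ d := Nat.ceil_le.2 <| by
        rw [div_le_iff₀ hpos, hdh]
        linarith [(hM hy).2]
      omega
    have hup : y ≤ a + (k + 1) * h := by
      have := Nat.le_ceil ((y - a) / h)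
      rw [hk, div_le_iff₀ hpos] at this
      push_cast at this
      linarith
    have hlo : a + k * h < y := by
      have := Nat.ceil_lt_add_one hq.le
      rw [hk, ← sub_lt_iff_lt_add, lt_div_iff₀ hpos] at this
      push_cast at this
      linarith
    have hmem : y ∈ Set.Ioc (g ⟨k, hkd⟩ - h) (g ⟨k, hkd⟩) := by
      have hgk : g ⟨k, hkd⟩ = a + ((k : ℝ) + 1) * h := hg _
      rw [hgk]
      exact ⟨by linarith, hup⟩
    refine Or.inr (Set.mem_iUnion₂.2 ⟨⟨k, hkd⟩, Finset.mem_filter.2 ⟨Finset.mem_univ _, y, hy, ?_⟩,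
      hmem⟩)
    exact abs_le.2 ⟨by linarith [hmem.1], by linarith [hmem.2]⟩
  have hfin : volume (⋃ j ∈ J, Set.Ioc (g j - h) (g j)) ≠ ⊤ :=
    (measure_biUnion_lt_top J.finite_toSet fun j _ => measure_Ioc_lt_top).ne
  calc volume.real M
      ≤ volume.real ({a} ∪ ⋃ j ∈ J, Set.Ioc (g j - h) (g j)) :=
        measureReal_mono hcover (measure_union_ne_top (by simp) hfin)
    _ ≤ volume.real {a} + volume.real (⋃ j ∈ J, Set.Ioc (g j - h) (g j)) :=
        measureReal_union_le _ _
    _ ≤ 0 + ∑ j ∈ J, volume.real (Set.Ioc (g j - h) (g j)) := by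
        gcongr
        · simp [Measure.real]
        · exact measureReal_biUnion_finset_le _ _
    _ = (J.card : ℝ) * h := by
        simp [hpos.le]
    _ = _ := by
        rw [Nat.card_eq_fintype_card, Fintype.card_subtype]

/-- A quantity that can eventually be made arbitrarily small tends to zero along suitable
choices. -/
theorem exists_choice_tendsto_zero {X : ℕ → Type*} {p : ∀ n, X n → Prop} {D : ∀ n, X n → ℝ}
    (hD : ∀ n x, 0 ≤ D n x) (hp : ∀ n, ∃ x, p n x)
    (h : ∀ ε > 0, ∀ᶠ n in atTop, ∃ x, p n x ∧ D n x ≤ ε) :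
    ∃ x : ∀ n, X n, (∀ n, p n (x n)) ∧ Tendsto (fun n => D n (x n)) atTop (nhds 0) := by
  let E : ∀ n, Set ℝ := fun n => D n '' {x | p n x}
  have hbdd : ∀ n, BddBelow (E n) := fun n => ⟨0, by
    rintro _ ⟨x, -, rfl⟩
    exact hD n x⟩
  have hch : ∀ n : ℕ, ∃ x, p n x ∧ D n x < sInf (E n) + 1 / ((n : ℝ) + 1) := by
    intro n
    obtain ⟨x, hx⟩ := hp n
    obtain ⟨_, ⟨x', hx', rfl⟩, hlt⟩ := exists_lt_of_csInf_lt (s := E n) ⟨_, x, hx, rfl⟩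
      (lt_add_of_pos_right _ (Nat.one_div_pos_of_nat (α := ℝ) (n := n)))
    exact ⟨x', hx', hlt⟩
  choose x hx hlt using hch
  refine ⟨x, hx, tendsto_order.2 ⟨fun c hc => Eventually.of_forall fun n => hc.trans_le (hD n _),
    fun c hc => ?_⟩⟩
  filter_upwards [h (c / 2) (half_pos hc),
    (tendsto_one_div_add_atTop_nhds_zero_nat (𝕜 := ℝ)).eventually_lt_const (half_pos hc)]
    with n ⟨y, hy, hyc⟩ hn
  linarith [hlt n, csInf_le (hbdd n) ⟨y, hy, rfl⟩]

/-- Up to an arbitrary tolerance, and for all large `n`, the given values are attained at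
perturbations of the points of the uniform grid. -/
theorem eventually_exists_perturbed_grid
    {a b : ℝ} (hab : a < b) {f : ℝ → ℝ}
    (hfbdd : ∃ C : ℝ, ∀ x ∈ Set.Icc a b, |f x| ≤ C)
    (hdisc : {x ∈ Set.Icc a b | ¬ ContinuousWithinAt f (Set.Icc a b) x}.Finite)
    (hlevel : ∀ y, {x ∈ Set.Icc a b | f x = y}.Finite)
    {dn : ℕ → ℕ} (hd : Tendsto dn atTop atTop) {lam : ∀ n, Fin (dn n) → ℝ}
    (hdistr : ∀ F : ℝ → ℂ, Continuous F → HasCompactSupport F →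
      Tendsto (fun n => (dn n : ℂ)⁻¹ * ∑ i : Fin (dn n), F (lam n i)) atTop
        (nhds (((volume (Set.Icc a b)).toReal)⁻¹ • ∫ y in Set.Icc a b, F (f y))))
    (hlam : ∀ n i, lam n i ∈ f '' Set.Icc a b) {ε : ℝ} (hε : 0 < ε) :
    ∀ᶠ n in atTop, ∃ x : Fin (dn n) → ℝ, (∀ i, x i ∈ Set.Icc a b) ∧
      (∃ τ : Equiv.Perm (Fin (dn n)), ∀ i, lam n (τ i) = f (x i)) ∧
      ∀ i, |x i - (a + (((i : ℕ) : ℝ) + 1) * (b - a) / (dn n : ℝ))| ≤ ε := by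
  classical
  obtain ⟨η, hη, hηε⟩ : ∃ η : ℝ, 0 < η ∧ 3 * η = ε := ⟨ε / 3, by linarith, by ring⟩
  obtain ⟨Y, hY, hlift⟩ := exists_finite_cell_lift hfbdd hdisc hη
  have hfm := aemeasurable_of_finite_discontinuities hdisc
  obtain ⟨C₀, hC₀⟩ := hfbdd
  set ν := (volume.restrict (Set.Icc a b)).map f with hν
  have hdistr' : ∀ F : ℝ → ℂ, Continuous F → HasCompactSupport F →
      Tendsto (fun n => (dn n : ℂ)⁻¹ * ∑ i : Fin (dn n), F (lam n i)) atTop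
        (nhds ((b - a)⁻¹ • ∫ z, F z ∂ν)) := by
    intro F hF hFc
    have := hdistr F hF hFc
    rwa [Real.volume_Icc, ENNReal.toReal_ofReal (by linarith),
      ← integral_map hfm hF.aestronglyMeasurable] at this
  let K : Set (Y → SignType) → Set ℝ := fun C => closure (cell Y ⁻¹' C) ∩ Set.Icc (-C₀) C₀
  have hK : ∀ C, IsCompact (K C) := fun C => isCompact_Icc.inter_left isClosed_closure
  let P : Set (Y → SignType) → Set ℝ := fun C => {x ∈ Set.Icc a b | cell Y (f x) ∈ C}
  have hPI : ∀ C, P C ⊆ Set.Icc a b := fun C x hx => hx.1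
  have hνK : ∀ C, ν.real (K C) ≤ volume.real (P C) := by
    intro C
    have hnull : volume (⋃ y ∈ Y, {x ∈ Set.Icc a b | f x = y}) = 0 :=
      (hY.biUnion fun y _ => hlevel y).measure_zero _
    have hsub : f ⁻¹' K C ∩ Set.Icc a b ⊆ P C ∪ ⋃ y ∈ Y, {x ∈ Set.Icc a b | f x = y} := by
      rintro x ⟨hxK, hx⟩
      rcases closure_preimage_cell_subset hY C hxK.1 with h | h
      · exact Or.inl ⟨hx, h⟩
      · exact Or.inr (Set.mem_biUnion h ⟨hx, rfl⟩)
    refine ENNReal.toReal_mono (measure_ne_top_of_subset (hPI C) measure_Icc_lt_top.ne) ?_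
    rw [hν, Measure.map_apply_of_aemeasurable hfm (hK C).measurableSet,
      Measure.restrict_apply' measurableSet_Icc]
    exact (measure_mono hsub).trans ((measure_union_le _ _).trans (by rw [hnull, add_zero]))
  have := hY.to_subtype
  have hstep : Tendsto (fun n => (b - a) / (dn n : ℝ)) atTop (nhds 0) :=
    (tendsto_natCast_atTop_atTop.comp hd).const_div_atTop _
  filter_upwards [eventually_all.2 fun C => eventually_card_mul_le_measureReal (sub_pos.2 hab)
    hdistr' (hK C) hη, hstep.eventually_lt_const hη, hd.eventually_gt_atTop 0]
    with n hcount hsmall hdpos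
  have hdpos' : (0 : ℝ) < dn n := by exact_mod_cast hdpos
  set g : Fin (dn n) → ℝ := fun j => a + (((j : ℕ) : ℝ) + 1) * (b - a) / (dn n : ℝ) with hg
  have hgI : ∀ j, g j ∈ Set.Icc a b := by
    intro j
    have hj : ((j : ℕ) : ℝ) + 1 ≤ dn n := by exact_mod_cast j.2
    have hba : 0 < b - a := sub_pos.2 hab
    constructor
    · have : 0 ≤ (((j : ℕ) : ℝ) + 1) * (b - a) / (dn n : ℝ) := by positivity
      simp only [hg]
      linarith
    · have : (((j : ℕ) : ℝ) + 1) * (b - a) / (dn n : ℝ) ≤ b - a := by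
        rw [div_le_iff₀ hdpos', mul_comm (b - a)]
        gcongr
      simp only [hg]
      linarith
  let near : Fin (dn n) → Finset (Fin (dn n)) := fun i =>
    Finset.univ.filter fun j => ∃ x ∈ Set.Icc a b, f x = lam n i ∧ |x - g j| ≤ ε
  have hall : ∀ S : Finset (Fin (dn n)), S.card ≤ (S.biUnion near).card := by
    intro S
    rcases S.eq_empty_or_nonempty with rfl | ⟨i₀, hi₀⟩
    · simp
    let C : Set (Y → SignType) := (fun i => cell Y (lam n i)) '' S
    have hnear : ∀ j, ∀ x ∈ P C, |x - g j| ≤ 2 * η → j ∈ S.biUnion near := by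
      rintro j x ⟨hx, i, hi, hcell⟩ hxj
      obtain ⟨x', hx', hfx', hxx'⟩ := hlift x hx (lam n i) hcell.symm
      refine Finset.mem_biUnion.2 ⟨i, hi, Finset.mem_filter.2 ⟨Finset.mem_univ _, x', hx', hfx', ?_⟩⟩
      have := abs_sub_le x' x (g j)
      rw [abs_sub_comm x' x] at this
      linarith
    by_cases hcov : ∀ j, ∃ x ∈ P C, |x - g j| < η
    · have : S.biUnion near = Finset.univ := Finset.eq_univ_of_forall fun j => by
        obtain ⟨x, hx, hxj⟩ := hcov j
        exact hnear j x hx (by linarith)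
      rw [this]
      exact Finset.card_le_univ S
    push Not at hcov
    obtain ⟨j₀, hj₀⟩ := hcov
    have hPne : (P C).Nonempty := by
      obtain ⟨x, hx, hfx⟩ := hlam n i₀
      exact ⟨x, hx, i₀, hi₀, by simp only [hfx]⟩
    have hgain := measureReal_add_le_measureReal_enlargement hη (hPI C) hPne (hgI j₀) hj₀
    have hgrid := measureReal_le_card_mul hab hdpos
      (M := {y ∈ Set.Icc a b | ∃ x ∈ P C, |x - y| < η}) fun y hy => hy.1
    have hS : S.card ≤ Nat.card {i // lam n i ∈ K C} := by
      rw [Nat.card_eq_fintype_card, Fintype.card_subtype]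
      refine Finset.card_le_card fun i hi => Finset.mem_filter.2 ⟨Finset.mem_univ _,
        subset_closure ⟨i, hi, rfl⟩, ?_⟩
      obtain ⟨x, hx, hfx⟩ := hlam n i
      exact hfx ▸ abs_le.1 (hC₀ x hx)
    have hJ : Nat.card {j : Fin (dn n) // ∃ y ∈ {y ∈ Set.Icc a b | ∃ x ∈ P C, |x - y| < η},
        |y - (a + (((j : ℕ) : ℝ) + 1) * (b - a) / (dn n : ℝ))| ≤ (b - a) / (dn n : ℝ)} ≤
        (S.biUnion near).card := by
      rw [Nat.card_eq_fintype_card, Fintype.card_subtype]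
      refine Finset.card_le_card fun j hj => ?_
      obtain ⟨-, y, ⟨-, x, hx, hxy⟩, hyj⟩ := Finset.mem_filter.1 hj
      exact hnear j x hx (by linarith [abs_sub_le x y (g j)])
    have hpos : 0 < (b - a) / (dn n : ℝ) := div_pos (sub_pos.2 hab) hdpos'
    refine hS.trans (le_trans ?_ hJ)
    have := (hcount C).trans ((add_le_add_left (hνK C) η).trans (hgain.trans hgrid))
    exact_mod_cast le_of_mul_le_mul_right this hpos
  obtain ⟨σ, hσ, hσnear⟩ :=
    (Finset.all_card_le_biUnion_card_iff_exists_injective near).1 hall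
  let e : Equiv.Perm (Fin (dn n)) := Equiv.ofBijective σ (Finite.injective_iff_bijective.1 hσ)
  have hx : ∀ j, ∃ x ∈ Set.Icc a b, f x = lam n (e.symm j) ∧ |x - g j| ≤ ε := fun j => by
    have := (Finset.mem_filter.1 (hσnear (e.symm j))).2
    rwa [show σ (e.symm j) = j from e.apply_symm_apply j] at this
  choose x hxI hfx hxg using hx
  exact ⟨x, hxI, ⟨e.symm, fun j => (hfx j).symm⟩, hxg⟩

/-- (Theorem `thm:mmd`.) Let `f : [a,b] → ℝ` be bounded with finitely many
(weak) local maximum points, (weak) local minimum points, and discontinuity points, and with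
essential range `[inf f, sup f]`. If `{Λ_n}_n ∼ f` and `Λ_n ⊆ f([a,b])` for every `n`, then
there exist an a.u. grid `{x_{i,n}} ⊂ [a,b]` and permutations `τ_n` such that
`λ_{τ_n(i),n} = f(x_{i,n})` for all `i` and `n`. -/
theorem stmt_2
    (a b : ℝ) (hab : a < b)
    (f : ℝ → ℝ)
    (hfbdd : ∃ C : ℝ, ∀ x ∈ Set.Icc a b, |f x| ≤ C)
    (hmax : {x ∈ Set.Icc a b | IsLocalMaxOn f (Set.Icc a b) x}.Finite)
    (hmin : {x ∈ Set.Icc a b | IsLocalMinOn f (Set.Icc a b) x}.Finite)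
    (hdisc : {x ∈ Set.Icc a b | ¬ ContinuousWithinAt f (Set.Icc a b) x}.Finite)
    (hER : {z : ℝ | ∀ ε : ℝ, 0 < ε → 0 < volume {x ∈ Set.Icc a b | |f x - z| < ε}}
      = Set.Icc (sInf (f '' Set.Icc a b)) (sSup (f '' Set.Icc a b)))
    (dn : ℕ → ℕ) (hd : Tendsto dn atTop atTop)
    (lam : ∀ n, Fin (dn n) → ℝ)
    (hdistr : ∀ F : ℝ → ℂ, Continuous F → HasCompactSupport F →
      Tendsto (fun n => (dn n : ℂ)⁻¹ * ∑ i : Fin (dn n), F (lam n i)) atTop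
        (nhds (((volume (Set.Icc a b)).toReal)⁻¹ • ∫ y in Set.Icc a b, F (f y))))
    (hlam : ∀ n i, lam n i ∈ f '' Set.Icc a b) :
    ∃ x : ∀ n, Fin (dn n) → ℝ,
      (∀ n i, x n i ∈ Set.Icc a b) ∧
      Tendsto (fun n => ⨆ i : Fin (dn n),
        |x n i - (a + (((i : ℕ) : ℝ) + 1) * (b - a) / (dn n : ℝ))|) atTop (nhds 0) ∧
      ∀ n, ∃ τ : Equiv.Perm (Fin (dn n)), ∀ i, lam n (τ i) = f (x n i) := by
  obtain ⟨x, hx, hlim⟩ := exists_choice_tendsto_zero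
    (X := fun n => Fin (dn n) → ℝ)
    (p := fun n x => (∀ i, x i ∈ Set.Icc a b) ∧
      ∃ τ : Equiv.Perm (Fin (dn n)), ∀ i, lam n (τ i) = f (x i))
    (D := fun n x => ⨆ i : Fin (dn n), |x i - (a + (((i : ℕ) : ℝ) + 1) * (b - a) / (dn n : ℝ))|)
    (fun n x => Real.iSup_nonneg fun i => abs_nonneg _)
    (fun n => by
      choose x hx hfx using hlam n
      exact ⟨x, hx, 1, fun i => (hfx i).symm⟩)
    (fun ε hε => by
      filter_upwards [eventually_exists_perturbed_grid hab hfbdd hdisc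
        (finite_levelSet hmax hmin hdisc) hd hdistr hlam hε] with n ⟨x, hx, hτ, hxε⟩
      exact ⟨x, ⟨hx, hτ⟩, Real.iSup_le hxε hε.le⟩)
  exact ⟨x, fun n => (hx n).1, hlim, fun n => (hx n).2⟩
end

section
/- Let f_1,…,f_k : [a,b] → ℝ be bounded and continuous almost everywhere with ER(f_j) = [inf_{[a,b]} f_j, sup_{[a,b]} f_j] for every j = 1,…,k. Let {Λ_n = {λ_{1,n},…,λ_{d_n,n}}}_n be a sequence of finite multisets of real numbers with d_n → ∞. Assume (i) {Λ_n}_n ∼ diag(f_1,…,f_k), and (ii) for every n there exists a partition {Λ̃_{n,1},…,Λ̃_{n,k}} of Λ_n such that, for every j = 1,…,k, |Λ̃_{n,j}|/d_n → 1/k as n → ∞ and Λ̃_{n,j} ⊆ [inf_{[a,b]} f_j − ε_n, sup_{[a,b]} f_j + ε_n] for some ε_n → 0. Then for every n there exists a partition {Λ_{n,1},…,Λ_{n,k}} of Λ_n such that for every j = 1,…,k: (a) |Λ_{n,j}| = |Λ̃_{n,j}|; (b) Λ_{n,j} ⊆ [inf_{[a,b]} f_j − δ_n, sup_{[a,b]}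 f_j + δ_n] for some δ_n → 0; (c) {Λ_{n,j}}_n ∼ f_j; and (d) writing Λ_{n,j} = {λ_{1,n}^{(j)},…,λ_{|Λ_{n,j}|,n}^{(j)}}, for every asymptotically uniform grid {x_{i,n}^{(j)}}_{i=1,…,|Λ_{n,j}|} in [a,b] contained in [a,b], if σ_{n,j} and τ_{n,j} are permutations of {1,…,|Λ_{n,j}|} sorting the vectors of samples f_j(x_{i,n}^{(j)}) and of values λ_{i,n}^{(j)} in increasing order, then max_{i=1,…,|Λ_{n,j}|} |f_j(x_{σ_{n,j}(i),n}^{(j)}) − λ_{τ_{n,j}(i),n}^{(j)}| → 0 as n → ∞. -/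
open MeasureTheory Filter

/-- For a sequence of asymptotically uniform grids, the piecewise constant interpolants of `g`
converge to `g` at every continuity point. -/
theorem tendsto_step_of_continuousWithinAt {E : Type*} [NormedAddCommGroup E]
    {a b : ℝ} (hab : a < b) {g : ℝ → E} {y : ℝ} (hy : y ∈ Set.Ioc a b)
    (hg : ContinuousWithinAt g (Set.Icc a b) y)
    {N : ℕ → ℕ} (hN : Tendsto N atTop atTop) {x : ℕ → ℕ → ℝ}
    (hx : ∀ n m, x n m ∈ Set.Icc a b) {r : ℕ → ℝ} (hr : Tendsto r atTop (nhds 0))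
    (hxr : ∀ n, ∀ m < N n, |x n m - (a + ((m : ℝ) + 1) * (b - a) / N n)| ≤ r n) :
    Tendsto (fun n => g (x n (⌈(y - a) * N n / (b - a)⌉₊ - 1))) atTop (nhds (g y)) := by
  have hba : 0 < b - a := sub_pos.2 hab
  have hNR : Tendsto (fun n => (N n : ℝ)) atTop atTop := tendsto_natCast_atTop_atTop.comp hN
  have hlim : Tendsto (fun n => (b - a) / (N n : ℝ) + r n) atTop (nhds 0) := by
    simpa using (hNR.const_div_atTop (b - a)).add hr
  refine hg.tendsto.comp (tendsto_nhdsWithin_iff.2 ⟨?_, Eventually.of_forall fun n => hx n _⟩)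
  rw [tendsto_iff_dist_tendsto_zero]
  refine squeeze_zero' (Eventually.of_forall fun n => dist_nonneg) ?_ hlim
  filter_upwards [hN.eventually_gt_atTop 0] with n hn
  have hn' : (0 : ℝ) < N n := by exact_mod_cast hn
  set w : ℝ := (y - a) * N n / (b - a) with hw
  have hw0 : 0 < w := by have := sub_pos.2 hy.1; positivity
  have hwN : w ≤ N n := by
    rw [hw, div_le_iff₀ hba]; nlinarith [hy.2]
  have hc0 : 0 < ⌈w⌉₊ := Nat.ceil_pos.2 hw0
  have hcN : ⌈w⌉₊ ≤ N n := Nat.ceil_le.2 hwN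
  obtain ⟨m, hm⟩ : ∃ m, ⌈w⌉₊ = m + 1 := ⟨⌈w⌉₊ - 1, by omega⟩
  have h1 := hxr n m (by omega)
  have h2 : w ≤ m + 1 := by have := Nat.le_ceil w; rw [hm] at this; exact_mod_cast this
  have h3 : (m : ℝ) + 1 < w + 1 := by
    have := Nat.ceil_lt_add_one hw0.le; rw [hm] at this; exact_mod_cast this
  have hyw : y = a + w * (b - a) / N n := by rw [hw]; field_simp; ring
  have h4 : |(a + ((m : ℝ) + 1) * (b - a) / N n) - y| ≤ (b - a) / N n := by
    have : (a + ((m : ℝ) + 1) * (b - a) / N n) - y = (m + 1 - w) * ((b - a) / N n) := by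
      rw [hyw]; ring
    rw [this, abs_of_nonneg (mul_nonneg (by linarith) (by positivity))]
    exact mul_le_of_le_one_left (by positivity) (by linarith)
  rw [hm, Nat.add_sub_cancel, Real.dist_eq]
  calc |x n m - y| ≤ _ := abs_sub_le _ (a + ((m : ℝ) + 1) * (b - a) / N n) _
    _ ≤ (b - a) / N n + r n := by linarith

theorem stronglyMeasurable_step {E : Type*} [NormedAddCommGroup E] (a b : ℝ) (N : ℕ) (c : ℕ → E) :
    StronglyMeasurable fun y : ℝ => c (⌈(y - a) * N / (b - a)⌉₊ - 1) := by
  have h : Measurable fun y : ℝ => ⌈(y - a) * N / (b - a)⌉₊ :=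
    Nat.measurable_ceil.comp (by fun_prop)
  exact (StronglyMeasurable.of_discrete (f := fun m : ℕ => c (m - 1))).comp_measurable h

theorem intervalIntegral_step {E : Type*} [NormedAddCommGroup E] [NormedSpace ℝ E]
    [CompleteSpace E] {a b : ℝ} (hab : a < b) {N : ℕ} (hN : 0 < N) (c : ℕ → E) {C : ℝ}
    (hc : ∀ m, ‖c m‖ ≤ C) :
    ∫ y in a..b, c (⌈(y - a) * N / (b - a)⌉₊ - 1)
      = ((b - a) / N) • ∑ m ∈ Finset.range N, c m := by
  have hba : 0 < b - a := sub_pos.2 hab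
  have hN' : (0 : ℝ) < N := by exact_mod_cast hN
  set t : ℕ → ℝ := fun m => a + m * ((b - a) / N) with ht
  have hint : ∀ m < N, IntervalIntegrable (fun y => c (⌈(y - a) * N / (b - a)⌉₊ - 1)) volume
      (t m) (t (m + 1)) := fun m _ =>
    (intervalIntegrable_const (c := C)).mono_fun
      (stronglyMeasurable_step a b N c).aestronglyMeasurable
      (Eventually.of_forall fun y => (hc _).trans (le_abs_self C))
  have h0 : t 0 = a := by simp [ht]
  have h1 : t N = b := by simp only [ht]; field_simp; ring
  have hsum := intervalIntegral.sum_integral_adjacent_intervals hint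
  rw [h0, h1] at hsum
  rw [← hsum, Finset.smul_sum]
  refine Finset.sum_congr rfl fun m _ => ?_
  have hpos : 0 < (b - a) / N := by positivity
  have hle : t m ≤ t (m + 1) := by simp only [ht]; push_cast; nlinarith
  have hcongr : ∫ y in t m..t (m + 1), c (⌈(y - a) * N / (b - a)⌉₊ - 1)
      = ∫ _ in t m..t (m + 1), c m := by
    refine intervalIntegral.integral_congr_ae (Eventually.of_forall fun y hy => ?_)
    rw [Set.uIoc_of_le hle] at hy
    have h2 : ⌈(y - a) * N / (b - a)⌉₊ = m + 1 := by
      have e : y = a + ((y - a) * N / (b - a)) * ((b - a) / N) := by field_simp; ring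
      simp only [ht, Set.mem_Ioc, Nat.cast_add, Nat.cast_one] at hy
      rw [Nat.ceil_eq_iff (by omega)]
      rw [e] at hy
      have hy1 := lt_of_mul_lt_mul_right (lt_of_add_lt_add_left hy.1) hpos.le
      have hy2 := le_of_mul_le_mul_right (le_of_add_le_add_left hy.2) hpos
      simpa using ⟨hy1, hy2⟩
    rw [h2, Nat.add_sub_cancel]
  rw [hcongr, intervalIntegral.integral_const]
  congr 1
  simp only [ht]; push_cast; ring

/-- The regular grid witnesses that a bounded a.e. continuous function is integrable. -/
theorem integrableOn_of_bounded_of_ae_continuousWithinAt {E : Type*} [NormedAddCommGroup E]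
    {a b : ℝ} (hab : a < b) {g : ℝ → E}
    {C : ℝ} (hC : ∀ x ∈ Set.Icc a b, ‖g x‖ ≤ C)
    (hg : ∀ᵐ x ∂(volume.restrict (Set.Icc a b)), ContinuousWithinAt g (Set.Icc a b) x) :
    IntegrableOn g (Set.Icc a b) := by
  have hba : 0 < b - a := sub_pos.2 hab
  let x : ℕ → ℕ → ℝ := fun n m => min b (a + ((m : ℝ) + 1) * (b - a) / n)
  have hmeas : AEStronglyMeasurable g (volume.restrict (Set.Icc a b)) := by
    rw [← restrict_Ioc_eq_restrict_Icc] at hg ⊢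
    refine aestronglyMeasurable_of_tendsto_ae atTop
      (f := fun n y => g (x n (⌈(y - a) * n / (b - a)⌉₊ - 1)))
      (fun n => (stronglyMeasurable_step a b n fun m => g (x n m)).aestronglyMeasurable) ?_
    filter_upwards [hg, ae_restrict_mem measurableSet_Ioc] with y hy hy'
    refine tendsto_step_of_continuousWithinAt hab hy' hy (N := fun n => n) tendsto_id
      (fun n m => ⟨le_min hab.le ?_, min_le_left _ _⟩) (r := fun _ => 0) tendsto_const_nhds ?_
    · have : 0 ≤ ((m : ℝ) + 1) * (b - a) / n := by positivity
      linarith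
    · intro n m hm
      have hn : (0 : ℝ) < n := by exact_mod_cast (by omega : 0 < n)
      have hm' : (m : ℝ) + 1 ≤ n := by exact_mod_cast hm
      have : ((m : ℝ) + 1) * (b - a) / n ≤ b - a := by
        rw [div_le_iff₀ hn]; nlinarith
      simp only [x]
      rw [min_eq_right (by linarith)]; simp
  exact IntegrableOn.of_bound (by simp) hmeas C
    ((ae_restrict_mem measurableSet_Icc).mono fun y hy => hC y hy)

/-- Averages of a bounded a.e. continuous function over asymptotically uniform grids converge to
its mean. -/
theorem tendsto_average_of_asymptotically_uniform {E : Type*} [NormedAddCommGroup E]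
    [NormedSpace ℝ E] [CompleteSpace E]
    {a b : ℝ} (hab : a < b) {g : ℝ → E} {C : ℝ} (hC : ∀ x ∈ Set.Icc a b, ‖g x‖ ≤ C)
    (hg : ∀ᵐ x ∂(volume.restrict (Set.Icc a b)), ContinuousWithinAt g (Set.Icc a b) x)
    {N : ℕ → ℕ} (hN : Tendsto N atTop atTop) (x : ∀ n, Fin (N n) → ℝ)
    (hx : ∀ n i, x n i ∈ Set.Icc a b)
    (hxu : Tendsto (fun n => ⨆ i : Fin (N n),
      |x n i - (a + (((i : ℕ) : ℝ) + 1) * (b - a) / (N n : ℝ))|) atTop (nhds 0)) :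
    Tendsto (fun n => (N n : ℝ)⁻¹ • ∑ i, g (x n i)) atTop
      (nhds ((b - a)⁻¹ • ∫ y in Set.Icc a b, g y)) := by
  have hba : 0 < b - a := sub_pos.2 hab
  let x' : ℕ → ℕ → ℝ := fun n m => if h : m < N n then x n ⟨m, h⟩ else a
  have hx' : ∀ n m, x' n m ∈ Set.Icc a b := by
    intro n m
    by_cases h : m < N n
    · simpa [x', h] using hx n ⟨m, h⟩
    · simp [x', h, hab.le]
  have hxr : ∀ n, ∀ m < N n, |x' n m - (a + ((m : ℝ) + 1) * (b - a) / N n)| ≤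
      ⨆ i : Fin (N n), |x n i - (a + (((i : ℕ) : ℝ) + 1) * (b - a) / (N n : ℝ))| := by
    intro n m hm
    have := le_ciSup (f := fun i : Fin (N n) =>
      |x n i - (a + (((i : ℕ) : ℝ) + 1) * (b - a) / (N n : ℝ))|) (Set.finite_range _).bddAbove ⟨m, hm⟩
    simpa [x', hm] using this
  have hDCT : Tendsto (fun n => ∫ y in Set.Icc a b, g (x' n (⌈(y - a) * N n / (b - a)⌉₊ - 1)))
      atTop (nhds (∫ y in Set.Icc a b, g y)) := by
    rw [← restrict_Ioc_eq_restrict_Icc] at hg ⊢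
    refine tendsto_integral_of_dominated_convergence (fun _ => C)
      (fun n => (stronglyMeasurable_step a b (N n) fun m => g (x' n m)).aestronglyMeasurable)
      (integrable_const C) (fun n => Eventually.of_forall fun y => hC _ (hx' _ _)) ?_
    filter_upwards [hg, ae_restrict_mem measurableSet_Ioc] with y hy hy'
    exact tendsto_step_of_continuousWithinAt hab hy' hy hN hx' hxu hxr
  refine (hDCT.const_smul (b - a)⁻¹).congr' ?_
  filter_upwards [hN.eventually_gt_atTop 0] with n hn
  rw [integral_Icc_eq_integral_Ioc, ← intervalIntegral.integral_of_le hab.le,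
    intervalIntegral_step hab hn (fun m => g (x' n m)) (fun m => hC _ (hx' n m)), smul_smul]
  congr 1
  · field_simp
  · rw [← Fin.sum_univ_eq_sum_range (fun m => g (x' n m))]
    exact Finset.sum_congr rfl fun i _ => by simp [x']

/-- A continuous compactly supported cutoff: `1` on `[-R, c]` and `0` outside `[-R - 1, d]`. -/
noncomputable def cutoff (R c d y : ℝ) : ℝ :=
  max 0 (min 1 (min (y + R + 1) ((d - y) / (d - c))))

theorem continuous_cutoff (R c d : ℝ) : Continuous (cutoff R c d) := by
  unfold cutoff; fun_prop

theorem cutoff_nonneg (R c d y : ℝ) : 0 ≤ cutoff R c d y := le_max_left _ _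

theorem cutoff_le_one (R c d y : ℝ) : cutoff R c d y ≤ 1 :=
  max_le zero_le_one (min_le_left _ _)

theorem cutoff_eq_zero {R c d y : ℝ} (hcd : c < d) (hy : d ≤ y) : cutoff R c d y = 0 := by
  refine max_eq_left ((min_le_right _ _).trans ((min_le_right _ _).trans ?_))
  exact div_nonpos_of_nonpos_of_nonneg (by linarith) (by linarith)

theorem cutoff_of_le {R c d y : ℝ} (hcd : c < d) (hy : y ≤ c) :
    cutoff R c d y = max 0 (min 1 (y + R + 1)) := by
  have : 1 ≤ (d - y) / (d - c) := by rw [one_le_div (by linarith)]; linarith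
  unfold cutoff
  rw [← min_assoc, min_eq_left ((min_le_left _ _).trans this)]

theorem cutoff_eq_one {R c d y : ℝ} (hcd : c < d) (hR : -R ≤ y) (hy : y ≤ c) :
    cutoff R c d y = 1 := by
  rw [cutoff_of_le hcd hy, min_eq_left (by linarith), max_eq_right zero_le_one]

theorem hasCompactSupport_cutoff {R c d : ℝ} (hcd : c < d) :
    HasCompactSupport (cutoff R c d) := by
  refine HasCompactSupport.intro (K := Set.Icc (-R - 1) d) isCompact_Icc fun y hy => ?_
  by_cases h : d ≤ y
  · exact cutoff_eq_zero hcd h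
  · have : y < -R - 1 := by by_contra h'; exact hy ⟨not_lt.1 h', (not_le.1 h).le⟩
    exact max_eq_left ((min_le_right _ _).trans ((min_le_left _ _).trans (by linarith)))

theorem cutoff_le_cutoff {R c z d : ℝ} (hcz : c < z) (hzd : z < d) (y : ℝ) :
    cutoff R c z y ≤ cutoff R z d y := by
  rcases le_total y z with h | h
  · rw [cutoff_of_le hzd h]
    exact max_le_max le_rfl (min_le_min le_rfl (min_le_left _ _))
  · rw [cutoff_eq_zero hcz h]; exact cutoff_nonneg _ _ _ _

theorem card_filter_le_sum {ι : Type*} [Fintype ι] (w : ι → ℝ) (s : ℝ) (h : ℝ → ℝ)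
    (h0 : ∀ y, 0 ≤ h y) (h1 : ∀ i, w i ≤ s → 1 ≤ h (w i)) :
    ((Finset.univ.filter fun i => w i ≤ s).card : ℝ) ≤ ∑ i, h (w i) := by
  rw [Finset.card_eq_sum_ones, Nat.cast_sum, Finset.sum_filter]
  refine Finset.sum_le_sum fun i _ => ?_
  split_ifs with hi
  · simpa using h1 i hi
  · exact h0 _

theorem sum_le_card_filter {ι : Type*} [Fintype ι] (w : ι → ℝ) (s : ℝ) (h : ℝ → ℝ)
    (h1 : ∀ y, h y ≤ 1) (h0 : ∀ y, s < y → h y ≤ 0) :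
    ∑ i, h (w i) ≤ ((Finset.univ.filter fun i => w i ≤ s).card : ℝ) := by
  rw [Finset.card_eq_sum_ones, Nat.cast_sum, Finset.sum_filter]
  refine Finset.sum_le_sum fun i _ => ?_
  split_ifs with hi
  · simpa using h1 _
  · exact h0 _ (not_le.1 hi)

theorem card_filter_comp_eq_sum {ι J : Type*} [Fintype ι] [Fintype J] [DecidableEq J]
    (p : ι → J) (P : J → Prop) [DecidablePred P] :
    (Finset.univ.filter fun i => P (p i)).card
      = ∑ j ∈ Finset.univ.filter P, (Finset.univ.filter fun i => p i = j).card := by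
  rw [Finset.card_eq_sum_card_fiberwise (f := p) (t := Finset.univ.filter P)
    (fun i hi => by simpa using hi)]
  refine Finset.sum_congr rfl fun j hj => ?_
  congr 1
  ext i
  simp only [Finset.mem_filter, Finset.mem_univ, true_and] at hj ⊢
  exact ⟨fun h => h.2, fun h => ⟨h ▸ hj, h⟩⟩

/-- Two labelled families, with equal label counts, with values asymptotically in the interval of
their label, and with the same limit distribution charging every neighbourhood of every point of
those intervals, have asymptotically interlacing counting functions. -/
theorem eventually_card_filter_le {J : Type*} [Fintype J] [DecidableEq J] {lo hi : J → ℝ}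
    (hlohi : ∀ j, lo j ≤ hi j) {N : ℕ → ℕ} {u v : ∀ n, Fin (N n) → ℝ}
    {p p' : ∀ n, Fin (N n) → J}
    (hcard : ∀ n j, (Finset.univ.filter fun i => p n i = j).card
      = (Finset.univ.filter fun i => p' n i = j).card)
    {ε : ℕ → ℝ} (hε : Tendsto ε atTop (nhds 0))
    (hu : ∀ n i, u n i ∈ Set.Icc (lo (p n i) - ε n) (hi (p n i) + ε n))
    (hv : ∀ n i, v n i ∈ Set.Icc (lo (p' n i) - ε n) (hi (p' n i) + ε n))
    {L : (ℝ → ℝ) → ℝ}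
    (hL : ∀ h₁ h₂ : ℝ → ℝ, Continuous h₁ → Continuous h₂ → (∀ y, h₁ y ≤ h₂ y) →
      ∀ j, ∀ z ∈ Set.Icc (lo j) (hi j), h₁ z < h₂ z → L h₁ < L h₂)
    (hLu : ∀ h : ℝ → ℝ, Continuous h → HasCompactSupport h →
      Tendsto (fun n => (N n : ℝ)⁻¹ * ∑ i, h (u n i)) atTop (nhds (L h)))
    (hLv : ∀ h : ℝ → ℝ, Continuous h → HasCompactSupport h →
      Tendsto (fun n => (N n : ℝ)⁻¹ * ∑ i, h (v n i)) atTop (nhds (L h)))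
    (s : ℝ) {η : ℝ} (hη : 0 < η) :
    ∀ᶠ n in atTop, (Finset.univ.filter fun i => u n i ≤ s).card
      ≤ (Finset.univ.filter fun i => v n i ≤ s + η).card := by
  by_cases hz : ∃ j, ∃ z ∈ Set.Icc (lo j) (hi j), s < z ∧ z < s + η
  · obtain ⟨j, z, hzj, hsz, hzs⟩ := hz
    obtain ⟨R, hR⟩ : ∃ R, ∀ j, -R ≤ lo j - 1 := by
      obtain ⟨r, hr⟩ := (Set.finite_range lo).bddBelow
      exact ⟨1 - r, fun j => by linarith [hr ⟨j, rfl⟩]⟩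
    have hlt : L (cutoff R s z) < L (cutoff R z (s + η)) := by
      refine hL _ _ (continuous_cutoff _ _ _) (continuous_cutoff _ _ _)
        (cutoff_le_cutoff hsz hzs) j z hzj ?_
      rw [cutoff_eq_zero hsz le_rfl, cutoff_eq_one hzs (by linarith [hR j, hzj.1]) le_rfl]
      exact zero_lt_one
    filter_upwards [(hLu _ (continuous_cutoff R s z) (hasCompactSupport_cutoff hsz)).eventually_lt
      (hLv _ (continuous_cutoff R z (s + η)) (hasCompactSupport_cutoff hzs)) hlt,
      hε.eventually_lt_const zero_lt_one] with n hn hεn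
    have h1 := card_filter_le_sum (u n) s (cutoff R s z) (cutoff_nonneg R s z) fun i hi =>
      (cutoff_eq_one hsz (by linarith [(hu n i).1, hR (p n i)]) hi).ge
    have h2 := sum_le_card_filter (v n) (s + η) (cutoff R z (s + η)) (cutoff_le_one R z (s + η))
      fun y hy => (cutoff_eq_zero hzs hy.le).le
    have h3 := lt_of_mul_lt_mul_left hn (by positivity)
    exact_mod_cast (h1.trans h3.le).trans h2
  · push Not at hz
    have hgap : ∀ j, lo j < s + η → hi j ≤ s := by
      intro j hj
      by_contra! h
      rcases lt_or_ge s (lo j) with h' | h'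
      · linarith [hz j (lo j) ⟨le_rfl, hlohi j⟩ h']
      · have := hz j (min (hi j) (s + η / 2)) ⟨le_min (hlohi j) (by linarith), min_le_left _ _⟩
          (lt_min h (by linarith))
        linarith [min_le_right (hi j) (s + η / 2)]
    filter_upwards [hε.eventually_lt_const hη] with n hεn
    calc (Finset.univ.filter fun i => u n i ≤ s).card
        ≤ (Finset.univ.filter fun i => hi (p n i) ≤ s).card := by
          refine Finset.card_le_card (Finset.monotone_filter_right _ fun i _ h => ?_)
          exact hgap _ (by linarith [(hu n i).1])
      _ = (Finset.univ.filter fun i => hi (p' n i) ≤ s).card := by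
          rw [card_filter_comp_eq_sum (p n) fun j => hi j ≤ s,
            card_filter_comp_eq_sum (p' n) fun j => hi j ≤ s,
            Finset.sum_congr rfl fun j _ => hcard n j]
      _ ≤ _ := by
          refine Finset.card_le_card (Finset.monotone_filter_right _ fun i _ h => ?_)
          linarith [(hv n i).2]

theorem le_of_card_filter_le {N : ℕ} {u v : Fin N → ℝ} (hu : Monotone u) (hv : Monotone v)
    {i : Fin N} {t : ℝ} (h : (Finset.univ.filter fun l => u l ≤ u i).card
      ≤ (Finset.univ.filter fun l => v l ≤ t).card) : v i ≤ t := by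
  by_contra! hlt
  have h1 : (Finset.Iic i).card ≤ (Finset.univ.filter fun l => u l ≤ u i).card :=
    Finset.card_le_card fun l hl => by simpa using hu (Finset.mem_Iic.1 hl)
  have h2 : (Finset.univ.filter fun l => v l ≤ t).card ≤ (Finset.Iio i).card :=
    Finset.card_le_card fun l hl => by
      rw [Finset.mem_Iio]
      by_contra! hil
      exact (hlt.trans_le (hv hil)).not_ge (by simpa using hl)
  rw [Fin.card_Iic] at h1
  rw [Fin.card_Iio] at h2
  omega

/-- One-sided uniform closeness of sorted families from pointwise interlacing of counts. -/
theorem eventually_le_add_of_eventually_card_filter_le {N : ℕ → ℕ} {u v : ∀ n, Fin (N n) → ℝ}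
    (hu : ∀ n, Monotone (u n)) (hv : ∀ n, Monotone (v n)) {R : ℝ}
    (hR : ∀ᶠ n in atTop, ∀ i, |u n i| ≤ R)
    (h : ∀ s η : ℝ, 0 < η → ∀ᶠ n in atTop, (Finset.univ.filter fun i => u n i ≤ s).card
      ≤ (Finset.univ.filter fun i => v n i ≤ s + η).card)
    {η : ℝ} (hη : 0 < η) : ∀ᶠ n in atTop, ∀ i, v n i ≤ u n i + η := by
  have hη2 : 0 < η / 2 := by positivity
  have hfin := (Filter.eventually_all_finset
    (Finset.Icc ⌈-R / (η / 2)⌉ ⌈R / (η / 2)⌉)).2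
    fun m _ => h ((m : ℝ) * (η / 2)) (η / 2) hη2
  filter_upwards [hR, hfin] with n hRn hn i
  set m : ℤ := ⌈u n i / (η / 2)⌉ with hm
  have hmem : m ∈ Finset.Icc ⌈-R / (η / 2)⌉ ⌈R / (η / 2)⌉ := by
    have := abs_le.1 (hRn i)
    rw [Finset.mem_Icc]
    exact ⟨Int.ceil_mono (by gcongr; exact this.1), Int.ceil_mono (by gcongr; exact this.2)⟩
  have h1 : u n i ≤ m * (η / 2) := (div_le_iff₀ hη2).1 (Int.le_ceil _)
  have h2 : m * (η / 2) < u n i + η / 2 := by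
    have := mul_lt_mul_of_pos_right (Int.ceil_lt_add_one (u n i / (η / 2))) hη2
    rw [add_mul, div_mul_cancel₀ _ hη2.ne', one_mul] at this
    exact this
  refine le_of_card_filter_le (hu n) (hv n) (le_trans ?_ ((hn m hmem).trans ?_))
  · exact Finset.card_le_card (Finset.monotone_filter_right _ fun l _ hl => le_trans hl h1)
  · exact Finset.card_le_card (Finset.monotone_filter_right _ fun l _ hl => by linarith)

/-- Sorted labelled families with the same limit distribution are uniformly close. -/
theorem tendsto_iSup_abs_sub_of_monotone {J : Type*} [Fintype J] [DecidableEq J] {lo hi : J → ℝ}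
    (hlohi : ∀ j, lo j ≤ hi j) {N : ℕ → ℕ} {u v : ∀ n, Fin (N n) → ℝ}
    (hum : ∀ n, Monotone (u n)) (hvm : ∀ n, Monotone (v n))
    {p p' : ∀ n, Fin (N n) → J}
    (hcard : ∀ n j, (Finset.univ.filter fun i => p n i = j).card
      = (Finset.univ.filter fun i => p' n i = j).card)
    {ε : ℕ → ℝ} (hε : Tendsto ε atTop (nhds 0))
    (hu : ∀ n i, u n i ∈ Set.Icc (lo (p n i) - ε n) (hi (p n i) + ε n))
    (hv : ∀ n i, v n i ∈ Set.Icc (lo (p' n i) - ε n) (hi (p' n i) + ε n))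
    {L : (ℝ → ℝ) → ℝ}
    (hL : ∀ h₁ h₂ : ℝ → ℝ, Continuous h₁ → Continuous h₂ → (∀ y, h₁ y ≤ h₂ y) →
      ∀ j, ∀ z ∈ Set.Icc (lo j) (hi j), h₁ z < h₂ z → L h₁ < L h₂)
    (hLu : ∀ h : ℝ → ℝ, Continuous h → HasCompactSupport h →
      Tendsto (fun n => (N n : ℝ)⁻¹ * ∑ i, h (u n i)) atTop (nhds (L h)))
    (hLv : ∀ h : ℝ → ℝ, Continuous h → HasCompactSupport h →
      Tendsto (fun n => (N n : ℝ)⁻¹ * ∑ i, h (v n i)) atTop (nhds (L h))) :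
    Tendsto (fun n => ⨆ i, |u n i - v n i|) atTop (nhds 0) := by
  obtain ⟨R, hR⟩ : ∃ R, ∀ (w : ∀ n, Fin (N n) → ℝ) (q : ∀ n, Fin (N n) → J),
      (∀ n i, w n i ∈ Set.Icc (lo (q n i) - ε n) (hi (q n i) + ε n)) →
      ∀ᶠ n in atTop, ∀ i, |w n i| ≤ R := by
    obtain ⟨r, hr⟩ := (Set.finite_range fun j => |lo j| + |hi j|).bddAbove
    refine ⟨r + 1, fun w q hw => ?_⟩
    filter_upwards [hε.eventually_lt_const zero_lt_one] with n hn i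
    have h1 : |lo (q n i)| + |hi (q n i)| ≤ r := hr ⟨q n i, rfl⟩
    have h2 := hw n i
    rw [abs_le]
    constructor
    · linarith [neg_abs_le (lo (q n i)), abs_nonneg (hi (q n i)), h2.1]
    · linarith [le_abs_self (hi (q n i)), abs_nonneg (lo (q n i)), h2.2]
  rw [Metric.tendsto_nhds]
  intro η hη
  have hη2 : 0 < η / 2 := by positivity
  filter_upwards [
    eventually_le_add_of_eventually_card_filter_le hum hvm (hR u p hu)
      (fun s _ h => eventually_card_filter_le hlohi hcard hε hu hv hL hLu hLv s h) hη2,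
    eventually_le_add_of_eventually_card_filter_le hvm hum (hR v p' hv)
      (fun s _ h => eventually_card_filter_le hlohi (fun n j => (hcard n j).symm) hε hv hu hL
        hLv hLu s h) hη2] with n h1 h2
  rw [Real.dist_0_eq_abs, abs_of_nonneg (Real.iSup_nonneg fun i => abs_nonneg _)]
  refine (Real.iSup_le (fun i => ?_) hη2.le).trans_lt (half_lt_self hη)
  rw [abs_le]
  exact ⟨by linarith [h1 i], by linarith [h2 i]⟩

theorem integrableOn_comp_of_ae_continuousWithinAt {E : Type*} [NormedAddCommGroup E]
    {a b : ℝ} (hab : a < b) {f : ℝ → ℝ} {C : ℝ} (hC : ∀ x ∈ Set.Icc a b, |f x| ≤ C)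
    (hf : ∀ᵐ x ∂(volume.restrict (Set.Icc a b)), ContinuousWithinAt f (Set.Icc a b) x)
    {F : ℝ → E} (hF : Continuous F) : IntegrableOn (fun y => F (f y)) (Set.Icc a b) := by
  obtain ⟨D, hD⟩ := (isCompact_Icc (a := -C) (b := C)).exists_bound_of_continuousOn hF.continuousOn
  exact integrableOn_of_bounded_of_ae_continuousWithinAt hab
    (fun x hx => hD _ (abs_le.1 (hC x hx)))
    (hf.mono fun x hx => hF.continuousAt.comp_continuousWithinAt hx)

theorem tendsto_average_comp_of_asymptotically_uniform {E : Type*} [NormedAddCommGroup E]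
    [NormedSpace ℝ E] [CompleteSpace E]
    {a b : ℝ} (hab : a < b) {f : ℝ → ℝ} {C : ℝ} (hC : ∀ x ∈ Set.Icc a b, |f x| ≤ C)
    (hf : ∀ᵐ x ∂(volume.restrict (Set.Icc a b)), ContinuousWithinAt f (Set.Icc a b) x)
    {F : ℝ → E} (hF : Continuous F)
    {N : ℕ → ℕ} (hN : Tendsto N atTop atTop) (x : ∀ n, Fin (N n) → ℝ)
    (hx : ∀ n i, x n i ∈ Set.Icc a b)
    (hxu : Tendsto (fun n => ⨆ i : Fin (N n),
      |x n i - (a + (((i : ℕ) : ℝ) + 1) * (b - a) / (N n : ℝ))|) atTop (nhds 0)) :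
    Tendsto (fun n => (N n : ℝ)⁻¹ • ∑ i, F (f (x n i))) atTop
      (nhds ((b - a)⁻¹ • ∫ y in Set.Icc a b, F (f y))) := by
  obtain ⟨D, hD⟩ := (isCompact_Icc (a := -C) (b := C)).exists_bound_of_continuousOn hF.continuousOn
  exact tendsto_average_of_asymptotically_uniform hab (g := fun y => F (f y))
    (fun x hx => hD _ (abs_le.1 (hC x hx)))
    (hf.mono fun x hx => hF.continuousAt.comp_continuousWithinAt hx) hN x hx hxu

/-- Strict monotonicity of `h ↦ ∫ h ∘ f` for test functions that differ at a point of the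
essential range of `f`. -/
theorem setIntegral_comp_lt_of_mem_essRange {a b : ℝ} (hab : a < b) {f : ℝ → ℝ} {C : ℝ}
    (hC : ∀ x ∈ Set.Icc a b, |f x| ≤ C)
    (hf : ∀ᵐ x ∂(volume.restrict (Set.Icc a b)), ContinuousWithinAt f (Set.Icc a b) x)
    {h₁ h₂ : ℝ → ℝ} (hh₁ : Continuous h₁) (hh₂ : Continuous h₂) (hle : ∀ y, h₁ y ≤ h₂ y)
    {z : ℝ} (hz : ∀ ε : ℝ, 0 < ε → 0 < volume {x ∈ Set.Icc a b | |f x - z| < ε})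
    (hlt : h₁ z < h₂ z) :
    ∫ y in Set.Icc a b, h₁ (f y) < ∫ y in Set.Icc a b, h₂ (f y) := by
  have hi₁ := integrableOn_comp_of_ae_continuousWithinAt hab hC hf hh₁
  have hi₂ := integrableOn_comp_of_ae_continuousWithinAt hab hC hf hh₂
  rw [← sub_pos, ← integral_sub hi₂ hi₁, integral_pos_iff_support_of_nonneg
    (fun y => sub_nonneg.2 (hle _)) (hi₂.sub hi₁)]
  obtain ⟨r, hr, hball⟩ := Metric.eventually_nhds_iff.1
    ((hh₁.tendsto z).eventually_lt (hh₂.tendsto z) hlt)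
  refine (hz r hr).trans_le ?_
  refine (measure_mono fun x hx => ?_).trans (Measure.le_restrict_apply (Set.Icc a b) _)
  exact ⟨(sub_pos.2 (hball (by simpa [Real.dist_eq] using hx.2))).ne', hx.1⟩

/-- Averages of a uniformly continuous function over uniformly close families have the same
limit. -/
theorem tendsto_average_of_close {E : Type*} [NormedAddCommGroup E] [NormedSpace ℝ E]
    {ι : ℕ → Type*} {S : ∀ n, Finset (ι n)} {u v : ∀ n, ι n → ℝ} {δ : ℕ → ℝ}
    (hδ : Tendsto δ atTop (nhds 0)) (huv : ∀ n, ∀ i ∈ S n, |u n i - v n i| ≤ δ n)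
    {F : ℝ → E} (hF : UniformContinuous F) {l : E}
    (hv : Tendsto (fun n => ((S n).card : ℝ)⁻¹ • ∑ i ∈ S n, F (v n i)) atTop (nhds l)) :
    Tendsto (fun n => ((S n).card : ℝ)⁻¹ • ∑ i ∈ S n, F (u n i)) atTop (nhds l) := by
  suffices h : Tendsto (fun n => ((S n).card : ℝ)⁻¹ • ∑ i ∈ S n, (F (u n i) - F (v n i))) atTop
      (nhds 0) by
    simpa [Finset.sum_sub_distrib, smul_sub] using h.add hv
  rw [Metric.tendsto_nhds]
  intro η hη
  obtain ⟨r, hr, hFr⟩ := Metric.uniformContinuous_iff.1 hF (η / 2) (half_pos hη)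
  filter_upwards [hδ.eventually_lt_const hr] with n hn
  rw [dist_zero_right, norm_smul, norm_inv, Real.norm_natCast]
  have hsum : ‖∑ i ∈ S n, (F (u n i) - F (v n i))‖ ≤ (S n).card * (η / 2) := by
    rw [← nsmul_eq_mul]
    refine norm_sum_le_of_le _ (fun i hi => ?_) |>.trans_eq (Finset.sum_const _)
    rw [← dist_eq_norm]
    exact (hFr (by rw [Real.dist_eq]; exact (huv n i hi).trans_lt hn)).le
  calc ((S n).card : ℝ)⁻¹ * ‖∑ i ∈ S n, (F (u n i) - F (v n i))‖
      ≤ ((S n).card : ℝ)⁻¹ * ((S n).card * (η / 2)) := by gcongr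
    _ = (((S n).card : ℝ)⁻¹ * (S n).card) * (η / 2) := by ring
    _ ≤ 1 * (η / 2) := by gcongr; exact inv_mul_le_one
    _ < η := by linarith

theorem card_fiber_comp_equiv {ι J : Type*} [Fintype ι] [DecidableEq J] (p : ι → J)
    (π : Equiv.Perm ι) (j : J) :
    (Finset.univ.filter fun i => p (π i) = j).card = (Finset.univ.filter fun i => p i = j).card :=
  Finset.card_equiv π (by simp)

theorem sum_fiber_comp_equiv {ι J E : Type*} [Fintype ι] [DecidableEq J] [AddCommMonoid E]
    (p : ι → J) (π : Equiv.Perm ι) (j : J) (F : ι → E) :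
    ∑ i ∈ Finset.univ.filter (fun i => p (π i) = j), F (π i)
      = ∑ i ∈ Finset.univ.filter (fun i => p i = j), F i :=
  Finset.sum_equiv π (by simp) (by simp)

theorem sum_fiber_eq_sum_equiv {ι κ J E : Type*} [Fintype ι] [Fintype κ] [DecidableEq J]
    [AddCommMonoid E] (p : ι → J) (j : J) (e : κ ≃ {i // p i = j}) (F : ι → E) :
    ∑ i ∈ Finset.univ.filter (fun i => p i = j), F i = ∑ l, F (e l).1 := by
  rw [Equiv.sum_comp e fun i => F i.1]
  exact Finset.sum_subtype _ (by simp) F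

theorem regular_grid_mem_Icc {a b : ℝ} (hab : a < b) {N : ℕ} (l : Fin N) :
    a + (((l : ℕ) : ℝ) + 1) * (b - a) / (N : ℝ) ∈ Set.Icc a b := by
  have hba : 0 < b - a := sub_pos.2 hab
  have hN : (0 : ℝ) < N := by exact_mod_cast l.pos
  have hl : ((l : ℕ) : ℝ) + 1 ≤ N := by exact_mod_cast l.isLt
  have h1 : (((l : ℕ) : ℝ) + 1) * (b - a) / (N : ℝ) ≤ b - a := by
    rw [div_le_iff₀ hN]; nlinarith
  have h0 : 0 ≤ (((l : ℕ) : ℝ) + 1) * (b - a) / (N : ℝ) := by positivity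
  constructor <;> linarith

/-- On every label class, sample the corresponding function on the regular grid: the samples stay
in the range of the function and are distributed like it. -/
theorem exists_labelled_samples {J : Type*} [Fintype J] [DecidableEq J] {a b : ℝ} (hab : a < b)
    {f : J → ℝ → ℝ} (hfbdd : ∀ j, ∃ C : ℝ, ∀ x ∈ Set.Icc a b, |f j x| ≤ C)
    (hfcont : ∀ j, ∀ᵐ x ∂(volume.restrict (Set.Icc a b)),
      ContinuousWithinAt (f j) (Set.Icc a b) x)
    {d : ℕ → ℕ} (p : ∀ n, Fin (d n) → J)
    (hp : ∀ j, Tendsto (fun n => (Finset.univ.filter fun i => p n i = j).card) atTop atTop) :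
    ∃ v : ∀ n, Fin (d n) → ℝ, (∀ n i, v n i ∈ f (p n i) '' Set.Icc a b) ∧
      ∀ {E : Type} [NormedAddCommGroup E] [NormedSpace ℝ E] [CompleteSpace E] (F : ℝ → E),
        Continuous F → ∀ j, Tendsto (fun n =>
          ((Finset.univ.filter fun i => p n i = j).card : ℝ)⁻¹ •
            ∑ i ∈ Finset.univ.filter (fun i => p n i = j), F (v n i)) atTop
          (nhds ((b - a)⁻¹ • ∫ y in Set.Icc a b, F (f j y))) := by
  let N : ℕ → J → ℕ := fun n j => (Finset.univ.filter fun i => p n i = j).card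
  let e : ∀ n j, Fin (N n j) ≃ {i // p n i = j} := fun n j =>
    (Fintype.equivFinOfCardEq (Fintype.card_subtype _)).symm
  let x : ∀ n j, Fin (N n j) → ℝ := fun n j l => a + (((l : ℕ) : ℝ) + 1) * (b - a) / (N n j : ℝ)
  let v : ∀ n, Fin (d n) → ℝ := fun n i => f (p n i) (x n (p n i) ((e n (p n i)).symm ⟨i, rfl⟩))
  have hv : ∀ n j (i : {i // p n i = j}), v n i.1 = f j (x n j ((e n j).symm i)) := by
    rintro n j ⟨i, rfl⟩
    rfl
  refine ⟨v, fun n i => ⟨_, regular_grid_mem_Icc hab _, rfl⟩, fun F hF j => ?_⟩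
  obtain ⟨C, hC⟩ := hfbdd j
  refine (tendsto_average_comp_of_asymptotically_uniform hab hC (hfcont j) hF (hp j)
    (fun n => x n j) (fun n l => regular_grid_mem_Icc hab l) (by simp [x, N])).congr fun n => ?_
  rw [sum_fiber_eq_sum_equiv (p n) j (e n j)]
  simp [hv, N]

theorem tendsto_average_of_tendsto_average_fiber {J : Type*} [Fintype J] [DecidableEq J]
    {d : ℕ → ℕ} {p : ∀ n, Fin (d n) → J} {c l : J → ℝ} {w : ∀ n, Fin (d n) → ℝ}
    (hp : ∀ j, Tendsto (fun n => ((Finset.univ.filter fun i => p n i = j).card : ℝ) / (d n : ℝ))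
      atTop (nhds (c j)))
    (hw : ∀ j, Tendsto (fun n => ((Finset.univ.filter fun i => p n i = j).card : ℝ)⁻¹ *
      ∑ i ∈ Finset.univ.filter (fun i => p n i = j), w n i) atTop (nhds (l j))) :
    Tendsto (fun n => (d n : ℝ)⁻¹ * ∑ i, w n i) atTop (nhds (∑ j, c j * l j)) := by
  refine (tendsto_finsetSum _ fun j _ => (hp j).mul (hw j)).congr fun n => ?_
  rw [← Finset.sum_fiberwise Finset.univ (p n) (w n), Finset.mul_sum]
  refine Finset.sum_congr rfl fun j _ => ?_
  rcases Finset.eq_empty_or_nonempty (Finset.univ.filter fun i => p n i = j) with h | h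
  · simp [h]
  · have : ((Finset.univ.filter fun i => p n i = j).card : ℝ) ≠ 0 := by
      exact_mod_cast h.card_pos.ne'
    field_simp

/-- (Theorem `eccoGi'`.) Let `f_1,…,f_k : [a,b] → ℝ` be bounded, continuous
a.e., with essential range `[inf f_j, sup f_j]`. Assume `{Λ_n}_n ∼ diag(f_1,…,f_k)` and that
for every `n` there is a partition of `Λ_n` (encoded by `p n : Fin (d_n) → Fin k`) with
`|Λ̃_{n,j}|/d_n → 1/k` and `Λ̃_{n,j} ⊆ [inf f_j − ε_n, sup f_j + ε_n]`, `ε_n → 0`. Then there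
is a partition (encoded by `q n`) satisfying (a) equal cardinalities, (b) containment in
`[inf f_j − δ_n, sup f_j + δ_n]` with `δ_n → 0`, (c) `{Λ_{n,j}}_n ∼ f_j`, and (d) the uniform
eigenvalue–sample convergence for every a.u. grid in `[a,b]` and sorting permutations. -/
theorem stmt_3
    (a b : ℝ) (hab : a < b) (k : ℕ) (hk : 0 < k)
    (f : Fin k → ℝ → ℝ)
    (hfbdd : ∀ j, ∃ C : ℝ, ∀ x ∈ Set.Icc a b, |f j x| ≤ C)
    (hfcont : ∀ j, ∀ᵐ x ∂(volume.restrict (Set.Icc a b)),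
      ContinuousWithinAt (f j) (Set.Icc a b) x)
    (hER : ∀ j, {z : ℝ | ∀ ε : ℝ, 0 < ε → 0 < volume {x ∈ Set.Icc a b | |f j x - z| < ε}}
      = Set.Icc (sInf (f j '' Set.Icc a b)) (sSup (f j '' Set.Icc a b)))
    (dn : ℕ → ℕ) (hd : Tendsto dn atTop atTop)
    (lam : ∀ n, Fin (dn n) → ℝ)
    (hdistr : ∀ F : ℝ → ℂ, Continuous F → HasCompactSupport F →
      Tendsto (fun n => (dn n : ℂ)⁻¹ * ∑ i : Fin (dn n), F (lam n i)) atTop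
        (nhds (((b - a)⁻¹ : ℝ) • ∫ y in Set.Icc a b, (∑ j : Fin k, F (f j y)) / (k : ℂ))))
    (p : ∀ n, Fin (dn n) → Fin k)
    (ε : ℕ → ℝ) (hε : Tendsto ε atTop (nhds 0))
    (hpcard : ∀ j : Fin k, Tendsto (fun n =>
        ((Finset.univ.filter (fun i => p n i = j)).card : ℝ) / (dn n : ℝ)) atTop
        (nhds (1 / (k : ℝ))))
    (hpmem : ∀ n i, lam n i ∈ Set.Icc (sInf (f (p n i) '' Set.Icc a b) - ε n)
        (sSup (f (p n i) '' Set.Icc a b) + ε n)) :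
    ∃ q : ∀ n, Fin (dn n) → Fin k, ∃ δ : ℕ → ℝ, Tendsto δ atTop (nhds 0) ∧
      ∀ j : Fin k,
        -- (a) equal cardinalities
        (∀ n, (Finset.univ.filter (fun i => q n i = j)).card
            = (Finset.univ.filter (fun i => p n i = j)).card) ∧
        -- (b) containment up to `δ_n`
        (∀ n i, q n i = j → lam n i ∈ Set.Icc (sInf (f j '' Set.Icc a b) - δ n)
            (sSup (f j '' Set.Icc a b) + δ n)) ∧
        -- (c) asymptotic distribution of the `j`-th part
        (∀ F : ℝ → ℂ, Continuous F → HasCompactSupport F →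
          Tendsto (fun n => (((Finset.univ.filter (fun i => q n i = j)).card : ℂ))⁻¹ *
              ∑ i ∈ Finset.univ.filter (fun i => q n i = j), F (lam n i)) atTop
            (nhds (((b - a)⁻¹ : ℝ) • ∫ y in Set.Icc a b, F (f j y)))) ∧
        -- (d) uniform convergence of sorted values to sorted samples on a.u. grids
        (∀ x : ∀ n, Fin ((Finset.univ.filter (fun i => q n i = j)).card) → ℝ,
          (∀ n i, x n i ∈ Set.Icc a b) →
          Tendsto (fun n => ⨆ i : Fin ((Finset.univ.filter (fun i => q n i = j)).card),
            |x n i - (a + (((i : ℕ) : ℝ) + 1) * (b - a)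
              / (((Finset.univ.filter (fun i => q n i = j)).card : ℝ)))|) atTop (nhds 0) →
          ∀ σ : ∀ n, Equiv.Perm (Fin ((Finset.univ.filter (fun i => q n i = j)).card)),
          ∀ e : ∀ n, Fin ((Finset.univ.filter (fun i => q n i = j)).card)
              ≃ {i : Fin (dn n) // q n i = j},
          (∀ n, Monotone fun i => f j (x n (σ n i))) →
          (∀ n, Monotone fun i => lam n (e n i).1) →
          Tendsto (fun n => ⨆ i : Fin ((Finset.univ.filter (fun i => q n i = j)).card),
            |f j (x n (σ n i)) - lam n (e n i).1|) atTop (nhds 0)) := by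
  have hba : 0 < b - a := sub_pos.2 hab
  have hk' : (0 : ℝ) < 1 / k := by positivity
  have hran : ∀ j, ∀ y ∈ f j '' Set.Icc a b,
      y ∈ Set.Icc (sInf (f j '' Set.Icc a b)) (sSup (f j '' Set.Icc a b)) := by
    intro j y hy
    obtain ⟨C, hC⟩ := hfbdd j
    refine ⟨csInf_le ⟨-C, ?_⟩ hy, le_csSup ⟨C, ?_⟩ hy⟩
    · rintro _ ⟨x, hx, rfl⟩; exact (abs_le.1 (hC x hx)).1
    · rintro _ ⟨x, hx, rfl⟩; exact (abs_le.1 (hC x hx)).2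
  have hlohi : ∀ j, sInf (f j '' Set.Icc a b) ≤ sSup (f j '' Set.Icc a b) := fun j =>
    (hran j (f j a) ⟨a, ⟨le_rfl, hab.le⟩, rfl⟩).1.trans
      (hran j (f j a) ⟨a, ⟨le_rfl, hab.le⟩, rfl⟩).2
  have hint : ∀ (j : Fin k) {E : Type} [NormedAddCommGroup E] {F : ℝ → E}, Continuous F →
      IntegrableOn (fun y => F (f j y)) (Set.Icc a b) := fun j _ _ _ hF => by
    obtain ⟨C, hC⟩ := hfbdd j
    exact integrableOn_comp_of_ae_continuousWithinAt hab hC (hfcont j) hF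
  have hlt : ∀ h₁ h₂ : ℝ → ℝ, Continuous h₁ → Continuous h₂ → (∀ y, h₁ y ≤ h₂ y) →
      ∀ j, ∀ z ∈ Set.Icc (sInf (f j '' Set.Icc a b)) (sSup (f j '' Set.Icc a b)), h₁ z < h₂ z →
      ∫ y in Set.Icc a b, h₁ (f j y) < ∫ y in Set.Icc a b, h₂ (f j y) := by
    intro h₁ h₂ hh₁ hh₂ hle j z hz hzlt
    obtain ⟨C, hC⟩ := hfbdd j
    rw [← hER j] at hz
    exact setIntegral_comp_lt_of_mem_essRange hab hC (hfcont j) hh₁ hh₂ hle hz hzlt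
  have hcardtop : ∀ j : Fin k,
      Tendsto (fun n => (Finset.univ.filter fun i => p n i = j).card) atTop atTop := by
    intro j
    rw [← tendsto_natCast_atTop_iff (R := ℝ)]
    refine ((hpcard j).pos_mul_atTop hk' (tendsto_natCast_atTop_atTop.comp hd)).congr' ?_
    filter_upwards [hd.eventually_gt_atTop 0] with n hn
    have : (dn n : ℝ) ≠ 0 := by exact_mod_cast hn.ne'
    simp [this]
  obtain ⟨v, hvmem, hvdistr⟩ := exists_labelled_samples hab hfbdd hfcont p hcardtop
  let L : (ℝ → ℝ) → ℝ := fun h =>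
    ∑ j : Fin k, 1 / (k : ℝ) * ((b - a)⁻¹ * ∫ y in Set.Icc a b, h (f j y))
  have hLlam : ∀ h : ℝ → ℝ, Continuous h → HasCompactSupport h →
      Tendsto (fun n => (dn n : ℝ)⁻¹ * ∑ i, h (lam n i)) atTop (nhds (L h)) := by
    intro h hh hs
    have hlim := hdistr (fun y => (h y : ℂ)) (Complex.continuous_ofReal.comp hh)
      (hs.comp_left (g := ((↑) : ℝ → ℂ)) Complex.ofReal_zero)
    have hval : (((b - a)⁻¹ : ℝ) • ∫ y in Set.Icc a b, (∑ j : Fin k, (h (f j y) : ℂ)) / (k : ℂ))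
        = ((L h : ℝ) : ℂ) := by
      rw [integral_div, integral_finsetSum _ fun j _ =>
        hint j (F := fun y => (h y : ℂ)) (Complex.continuous_ofReal.comp hh)]
      simp only [L, Complex.real_smul, integral_complex_ofReal]
      push_cast
      rw [Finset.sum_div, Finset.mul_sum]
      exact Finset.sum_congr rfl fun j _ => by ring
    rw [hval] at hlim
    refine (Complex.continuous_re.continuousAt.tendsto.comp hlim).congr fun n => ?_
    simp only [Function.comp]
    rw [← Complex.ofReal_re ((dn n : ℝ)⁻¹ * ∑ i, h (lam n i))]
    push_cast
    rfl
  have hLv : ∀ h : ℝ → ℝ, Continuous h → HasCompactSupport h →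
      Tendsto (fun n => (dn n : ℝ)⁻¹ * ∑ i, h (v n i)) atTop (nhds (L h)) := fun h hh _ =>
    tendsto_average_of_tendsto_average_fiber hpcard fun j => hvdistr h hh j
  have hLmono : ∀ h₁ h₂ : ℝ → ℝ, Continuous h₁ → Continuous h₂ → (∀ y, h₁ y ≤ h₂ y) →
      ∀ j, ∀ z ∈ Set.Icc (sInf (f j '' Set.Icc a b)) (sSup (f j '' Set.Icc a b)), h₁ z < h₂ z →
      L h₁ < L h₂ := by
    intro h₁ h₂ hh₁ hh₂ hle j z hz hzlt
    refine Finset.sum_lt_sum (fun i _ => ?_) ⟨j, Finset.mem_univ _, ?_⟩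
    · have := integral_mono (hint i hh₁) (hint i hh₂) fun y => hle _
      gcongr
    · have := hlt h₁ h₂ hh₁ hh₂ hle j z hz hzlt
      gcongr
  let σ₀ : ∀ n, Equiv.Perm (Fin (dn n)) := fun n => Tuple.sort (lam n)
  let τ₀ : ∀ n, Equiv.Perm (Fin (dn n)) := fun n => Tuple.sort (v n)
  let π : ∀ n, Equiv.Perm (Fin (dn n)) := fun n => (σ₀ n).symm.trans (τ₀ n)
  let δ : ℕ → ℝ := fun n => ⨆ i, |lam n (σ₀ n i) - v n (τ₀ n i)|
  have hδ : Tendsto δ atTop (nhds 0) := by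
    refine tendsto_iSup_abs_sub_of_monotone hlohi (u := fun n i => lam n (σ₀ n i))
      (v := fun n i => v n (τ₀ n i)) (p := fun n i => p n (σ₀ n i)) (p' := fun n i => p n (τ₀ n i))
      (fun n => Tuple.monotone_sort (lam n)) (fun n => Tuple.monotone_sort (v n))
      (fun n j => by rw [card_fiber_comp_equiv, card_fiber_comp_equiv])
      (ε := fun n => |ε n|) (by simpa using hε.abs) (fun n i => ?_) (fun n i => ?_)
      hLmono (fun h hh hs => ?_) (fun h hh hs => ?_)
    · have := hpmem n (σ₀ n i)
      exact ⟨by linarith [this.1, le_abs_self (ε n)], by linarith [this.2, le_abs_self (ε n)]⟩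
    · have := hran _ _ (hvmem n (τ₀ n i))
      exact ⟨by linarith [this.1, abs_nonneg (ε n)], by linarith [this.2, abs_nonneg (ε n)]⟩
    · exact (hLlam h hh hs).congr fun n => by rw [Equiv.sum_comp (σ₀ n) fun i => h (lam n i)]
    · exact (hLv h hh hs).congr fun n => by rw [Equiv.sum_comp (τ₀ n) fun i => h (v n i)]
  have hδ0 : ∀ n, 0 ≤ δ n := fun n => Real.iSup_nonneg fun i => abs_nonneg _
  have hclose : ∀ n i, |lam n i - v n (π n i)| ≤ δ n := by
    intro n i
    have := le_ciSup (f := fun i => |lam n (σ₀ n i) - v n (τ₀ n i)|)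
      (Set.finite_range _).bddAbove ((σ₀ n).symm i)
    simpa [π] using this
  have hqcard : ∀ n j, (Finset.univ.filter fun i => p n (π n i) = j).card
      = (Finset.univ.filter fun i => p n i = j).card := fun n j => card_fiber_comp_equiv _ _ _
  have hqmem : ∀ n j i, p n (π n i) = j → lam n i ∈ Set.Icc (sInf (f j '' Set.Icc a b) - δ n)
      (sSup (f j '' Set.Icc a b) + δ n) := by
    rintro n _ i rfl
    have h1 := hran _ _ (hvmem n (π n i))
    have h2 := abs_le.1 (hclose n i)
    exact ⟨by linarith [h1.1, h2.1], by linarith [h1.2, h2.2]⟩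
  have hqdistr : ∀ {E : Type} [NormedAddCommGroup E] [NormedSpace ℝ E] [CompleteSpace E]
      (F : ℝ → E), Continuous F → HasCompactSupport F → ∀ j, Tendsto (fun n =>
        ((Finset.univ.filter fun i => p n (π n i) = j).card : ℝ)⁻¹ •
          ∑ i ∈ Finset.univ.filter (fun i => p n (π n i) = j), F (lam n i)) atTop
        (nhds ((b - a)⁻¹ • ∫ y in Set.Icc a b, F (f j y))) := by
    intro E _ _ _ F hF hs j
    refine tendsto_average_of_close hδ (v := fun n i => v n (π n i)) (fun n i _ => hclose n i)
      (hs.uniformContinuous_of_continuous hF) ((hvdistr F hF j).congr fun n => ?_)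
    rw [hqcard, sum_fiber_comp_equiv (p n) (π n) j fun i => F (v n i)]
  refine ⟨fun n i => p n (π n i), δ, hδ, fun j => ⟨fun n => hqcard n j, fun n i => hqmem n j i,
    fun F hF hs => ?_, fun x hx hxu σ e hσ he => ?_⟩⟩
  · refine (hqdistr F hF hs j).congr fun n => ?_
    rw [Complex.real_smul]
    push_cast
    rfl
  · obtain ⟨C, hC⟩ := hfbdd j
    refine tendsto_iSup_abs_sub_of_monotone (fun _ : Unit => hlohi j)
      (u := fun n i => f j (x n (σ n i))) (v := fun n i => lam n (e n i).1)
      (p := fun _ _ => ()) (p' := fun _ _ => ()) hσ he (fun _ _ => rfl) hδ (fun n i => ?_)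
      (fun n i => hqmem n j _ (e n i).2)
      (L := fun h => (b - a)⁻¹ * ∫ y in Set.Icc a b, h (f j y))
      (fun h₁ h₂ hh₁ hh₂ hle _ z hz hzlt => ?_) (fun h hh hs => ?_) (fun h hh hs => ?_)
    · have := hran j _ ⟨_, hx n (σ n i), rfl⟩
      exact ⟨by linarith [this.1, hδ0 n], by linarith [this.2, hδ0 n]⟩
    · have := hlt h₁ h₂ hh₁ hh₂ hle j z hz hzlt
      gcongr
    · refine (tendsto_average_comp_of_asymptotically_uniform hab hC (hfcont j) hh
        (by simpa only [hqcard] using hcardtop j) x hx hxu).congr fun n => ?_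
      rw [smul_eq_mul, Equiv.sum_comp (σ n) fun i => h (f j (x n i))]
    · refine (hqdistr h hh hs j).congr fun n => ?_
      rw [smul_eq_mul, sum_fiber_eq_sum_equiv _ j (e n)]
end

section
/- Let f_1,…,f_k : [a,b] → ℝ be measurable and let {Λ_n = {λ_{1,n},…,λ_{d_n,n}}}_n be a sequence of finite multisets of real numbers with d_n → ∞. Assume (i) {Λ_n}_n ∼ diag(f_1,…,f_k), and (ii) {L_{n,1}}_n,…,{L_{n,k}}_n are sequences of natural numbers with L_{n,1} + … + L_{n,k} = d_n for every n and L_{n,j}/d_n → 1/k as n → ∞ for every j = 1,…,k. Then for every n there exists a partition {Λ_{n,1},…,Λ_{n,k}} of Λ_n such that, for every j = 1,…,k, |Λ_{n,j}| = L_{n,j} and {Λ_{n,j}}_n ∼ f_j. -/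
open MeasureTheory Filter

open scoped ENNReal Topology

/-- The lower bound in the portmanteau theorem holds under vague convergence. -/
theorem measure_le_liminf_of_tendsto_integral_of_hasCompactSupport
    {ι : Type*} {l : Filter ι} {μ : Measure ℝ} {μs : ι → Measure ℝ}
    [IsProbabilityMeasure μ] [∀ i, IsProbabilityMeasure (μs i)]
    (h : ∀ F : ℝ → ℝ, Continuous F → HasCompactSupport F →
      Tendsto (fun i => ∫ x, F x ∂(μs i)) l (𝓝 (∫ x, F x ∂μ)))
    {G : Set ℝ} (hG : IsOpen G) : μ G ≤ liminf (fun i => μs i G) l := by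
  refine le_of_forall_lt fun r hr => ?_
  obtain ⟨K, hKG, hK, hrK⟩ := hG.exists_lt_isCompact hr
  obtain ⟨F, hF1, hFc, hFG, hF01⟩ :=
    exists_continuousMap_one_of_isCompact_subset_isOpen hK hG hKG
  have hint (ν : Measure ℝ) [IsProbabilityMeasure ν] : Integrable F ν :=
    F.continuous.integrable_of_hasCompactSupport hFc
  have hlow : μ.real K ≤ ∫ x, F x ∂μ := by
    rw [← integral_indicator_one hK.measurableSet]
    refine integral_mono ((integrable_const 1).indicator hK.measurableSet) (hint μ) fun x => ?_
    by_cases hx : x ∈ K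
    · simp [hx, hF1 hx]
    · simpa [hx] using (hF01 x).1
  have hup (i : ι) : ∫ x, F x ∂(μs i) ≤ (μs i).real G := by
    rw [← integral_indicator_one hG.measurableSet]
    refine integral_mono (hint _) ((integrable_const 1).indicator hG.measurableSet) fun x => ?_
    by_cases hx : x ∈ G
    · simpa [hx] using (hF01 x).2
    · simp [hx, image_eq_zero_of_notMem_tsupport fun hx' => hx (hFG hx')]
  have hrtop : r ≠ ∞ := hr.ne_top
  have hrK' : r.toReal < μ.real K :=
    (ENNReal.toReal_lt_toReal hrtop (measure_ne_top μ K)).2 hrK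
  obtain ⟨s, hrs, hsK⟩ := exists_between hrK'
  have hs : r < ENNReal.ofReal s := (ENNReal.lt_ofReal_iff_toReal_lt hrtop).2 hrs
  refine hs.trans_le (le_liminf_of_le (by isBoundedDefault) ?_)
  filter_upwards [(h F F.continuous hFc).eventually_const_lt (hsK.trans_le hlow)] with i hi
  exact ENNReal.ofReal_le_of_le_toReal (hi.le.trans (hup i))

/-- Convergence of distribution functions on a dense set of points implies weak convergence. -/
theorem tendsto_probabilityMeasure_of_tendsto_Iic
    {ι : Type*} {l : Filter ι} [l.IsCountablyGenerated]
    {μ : ProbabilityMeasure ℝ} {μs : ι → ProbabilityMeasure ℝ} {D : Set ℝ} (hD : Dense D)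
    (h : ∀ t ∈ D, Tendsto (fun i => (μs i : Measure ℝ).real (Set.Iic t)) l
      (𝓝 ((μ : Measure ℝ).real (Set.Iic t)))) :
    Tendsto μs l (𝓝 μ) := by
  refine (isPiSystem_Ioc_mem D D).tendsto_probabilityMeasure_of_tendsto_of_mem ?_ ?_ ?_
  · rintro _ ⟨s, -, t, -, -, rfl⟩
    exact measurableSet_Ioc
  · intro u hu x hx
    obtain ⟨p, q, hxpq, hpq⟩ := mem_nhds_iff_exists_Ioo_subset.1 (hu.mem_nhds hx)
    obtain ⟨s, hs, hps, hsx⟩ := hD.exists_between hxpq.1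
    obtain ⟨t, ht, hxt, htq⟩ := hD.exists_between hxpq.2
    exact ⟨_, ⟨s, hs, t, ht, hsx.trans hxt, rfl⟩, Ioc_mem_nhds hsx hxt,
      fun y hy => hpq ⟨hps.trans hy.1, hy.2.trans_lt htq⟩⟩
  · rintro _ ⟨s, hs, t, ht, hst, rfl⟩
    have key (ν : ProbabilityMeasure ℝ) : ((ν (Set.Ioc s t) : NNReal) : ℝ)
        = (ν : Measure ℝ).real (Set.Iic t) - (ν : Measure ℝ).real (Set.Iic s) := by
      have hIoc : Set.Ioc s t = Set.Iic t \ Set.Iic s := by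
        ext y
        simp [and_comm]
      rw [← measureReal_sdiff (Set.Iic_subset_Iic.2 hst.le) measurableSet_Iic, ← hIoc]
      simp
    rw [← NNReal.tendsto_coe]
    simp only [key]
    exact (h t ht).sub (h s hs)

/-- The points which are not atoms of a probability measure on the line are dense. -/
theorem dense_setOf_measure_singleton_eq_zero (μ : Measure ℝ) [IsProbabilityMeasure μ] :
    Dense {t : ℝ | μ {t} = 0} := by
  have h := (Measure.countable_meas_level_set_pos (μ := μ) measurable_id).dense_compl ℝ
  refine h.mono fun t ht => ?_
  simpa using ht

/-- Existence of quantiles. -/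
theorem exists_forall_le_iff_le_cdf (ν : Measure ℝ) {u : ℝ} (hu0 : 0 < u) (hu1 : u < 1) :
    ∃ x : ℝ, ∀ t, x ≤ t ↔ u ≤ ProbabilityTheory.cdf ν t := by
  set G := ProbabilityTheory.cdf ν
  have hne : {t | u ≤ G t}.Nonempty :=
    (((ProbabilityTheory.tendsto_cdf_atTop ν).eventually_const_lt hu1).mono
      fun _ => le_of_lt).exists
  have hbdd : BddBelow {t | u ≤ G t} := by
    obtain ⟨m, hm⟩ := ((ProbabilityTheory.tendsto_cdf_atBot ν).eventually_lt_const hu0).exists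
    refine ⟨m, fun t ht => ?_⟩
    by_contra! htm
    exact (hm.trans_le ht).not_ge (G.mono htm.le)
  refine ⟨sInf {t | u ≤ G t}, fun t => ⟨fun h => ?_, fun h => csInf_le hbdd h⟩⟩
  refine le_trans ?_ (G.mono h)
  have hcont : Tendsto G (𝓝[>] (sInf {t | u ≤ G t})) (𝓝 (G (sInf {t | u ≤ G t}))) :=
    (G.right_continuous _).mono_left (nhdsWithin_mono _ Set.Ioi_subset_Ici_self)
  refine ge_of_tendsto hcont ?_
  filter_upwards [self_mem_nhdsWithin] with s hs
  obtain ⟨r, hr, hrs⟩ := exists_lt_of_csInf_lt hne hs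
  exact le_trans hr (G.mono hrs.le)

/-- A probability measure on the line is approximated by `L` points with error at most `1` in
the counting function. -/
theorem exists_points_card_sub_le (ν : Measure ℝ) [IsProbabilityMeasure ν] (L : ℕ) :
    ∃ x : Fin L → ℝ, ∀ t : ℝ,
      |((Finset.univ.filter fun i => x i ≤ t).card : ℝ) - L * ν.real (Set.Iic t)| ≤ 1 := by
  have hq (i : Fin L) : ∃ x : ℝ, ∀ t, x ≤ t ↔
      ((i : ℝ) + 1 / 2) / L ≤ ProbabilityTheory.cdf ν t := by
    have hi : ((i : ℕ) : ℝ) + 1 ≤ L := by exact_mod_cast i.2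
    have hL : (0 : ℝ) < L := by exact_mod_cast i.pos
    refine exists_forall_le_iff_le_cdf ν (by positivity) ?_
    rw [div_lt_one hL]
    linarith
  choose x hx using hq
  refine ⟨x, fun t => ?_⟩
  have h0 := ProbabilityTheory.cdf_nonneg ν t
  have h1 := ProbabilityTheory.cdf_le_one ν t
  rw [← ProbabilityTheory.cdf_eq_real]
  set g := ProbabilityTheory.cdf ν t
  set m := ⌊(L : ℝ) * g + 1 / 2⌋₊
  have hg0 : 0 ≤ (L : ℝ) * g + 1 / 2 := by positivity
  have hm1 : (m : ℝ) ≤ L * g + 1 / 2 := Nat.floor_le hg0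
  have hm2 : (L : ℝ) * g + 1 / 2 < m + 1 := Nat.lt_floor_add_one _
  have hmL : m ≤ L := by
    have : (m : ℝ) < L + 1 := by nlinarith [(Nat.cast_nonneg L : (0 : ℝ) ≤ L)]
    exact Nat.lt_succ_iff.1 (by exact_mod_cast this)
  have hcard : (Finset.univ.filter fun i => x i ≤ t).card = m := by
    have : (Finset.univ.filter fun i => x i ≤ t)
        = Finset.univ.filter fun i : Fin L => (i : ℕ) < m := by
      ext i
      have hL : (0 : ℝ) < L := by exact_mod_cast i.pos
      simp only [Finset.mem_filter_univ, hx, div_le_iff₀ hL]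
      rw [← Nat.succ_le_iff, Nat.le_floor_iff hg0]
      push_cast
      constructor <;> intro h <;> linarith
    rw [this, Fin.card_filter_val_lt, min_eq_right hmL]
  rw [hcard, abs_le]
  constructor <;> linarith

/-- Matching two families of reals in increasing order. -/
theorem exists_equiv_sublevel_subset_or_subset {d : ℕ} {ι : Type*} [Fintype ι]
    (hι : Fintype.card ι = d) (y : Fin d → ℝ) (x : ι → ℝ) :
    ∃ e : Fin d ≃ ι, ∀ t : ℝ, {i | y i ≤ t} ⊆ {i | x (e i) ≤ t} ∨
      {i | x (e i) ≤ t} ⊆ {i | y i ≤ t} := by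
  let e₀ : Fin d ≃ ι := (Fintype.equivFinOfCardEq hι).symm
  let σ := Tuple.sort y
  let τ := Tuple.sort (x ∘ e₀)
  have hσ : Monotone (y ∘ σ) := Tuple.monotone_sort y
  have hτ : Monotone ((x ∘ e₀) ∘ τ) := Tuple.monotone_sort (x ∘ e₀)
  refine ⟨(σ.symm.trans τ).trans e₀, fun t => ?_⟩
  have h1 : IsLowerSet {i | (y ∘ σ) i ≤ t} := fun i j hji hi => (hσ hji).trans hi
  have h2 : IsLowerSet {i | ((x ∘ e₀) ∘ τ) i ≤ t} := fun i j hji hi => (hτ hji).trans hi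
  refine (h1.total h2).imp (fun h i hi => ?_) (fun h i hi => ?_)
  · exact h (a := σ.symm i) (by simpa using hi)
  · simpa using h (a := σ.symm i) hi

/-- Matching two families of reals in increasing order changes the counting function of a
subfamily by at most the difference of the total counting functions. -/
theorem exists_equiv_card_filter_sub_le {d : ℕ} {ι : Type*} [Fintype ι]
    (hι : Fintype.card ι = d) (y : Fin d → ℝ) (x : ι → ℝ) :
    ∃ e : Fin d ≃ ι, ∀ (p : ι → Prop) [DecidablePred p] (t : ℝ),
      |((Finset.univ.filter fun i => p (e i) ∧ y i ≤ t).card : ℝ)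
          - (Finset.univ.filter fun s => p s ∧ x s ≤ t).card|
        ≤ |((Finset.univ.filter fun i => y i ≤ t).card : ℝ)
          - (Finset.univ.filter fun s => x s ≤ t).card| := by
  obtain ⟨e, he⟩ := exists_equiv_sublevel_subset_or_subset hι y x
  refine ⟨e, fun p _ t => ?_⟩
  have hc (q : ι → Prop) [DecidablePred q] : (Finset.univ.filter q).card
      = (Finset.univ.filter fun i => q (e i)).card :=
    (Finset.card_equiv e (by simp)).symm
  rw [hc, hc (fun s => x s ≤ t)]
  have key (u v : Fin d → Prop) [DecidablePred u] [DecidablePred v] (huv : ∀ i, u i → v i) :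
      |((Finset.univ.filter fun i => p (e i) ∧ u i).card : ℝ)
          - (Finset.univ.filter fun i => p (e i) ∧ v i).card|
        ≤ |((Finset.univ.filter u).card : ℝ) - (Finset.univ.filter v).card| := by
    have h1 : (Finset.univ.filter v).card
        = (Finset.univ.filter u).card + (Finset.univ.filter fun i => v i ∧ ¬ u i).card := by
      rw [← Finset.card_union_of_disjoint]
      · congr 1; ext i; simp; grind
      · rw [Finset.disjoint_filter]; grind
    have h2 : (Finset.univ.filter fun i => p (e i) ∧ v i).card
        = (Finset.univ.filter fun i => p (e i) ∧ u i).card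
          + (Finset.univ.filter fun i => p (e i) ∧ v i ∧ ¬ u i).card := by
      rw [← Finset.card_union_of_disjoint]
      · congr 1; ext i; simp; grind
      · rw [Finset.disjoint_filter]; grind
    have h3 : (Finset.univ.filter fun i => p (e i) ∧ v i ∧ ¬ u i).card
        ≤ (Finset.univ.filter fun i => v i ∧ ¬ u i).card :=
      Finset.card_le_card fun i => by simp
    rw [h1, h2]
    push_cast
    simp only [sub_add_cancel_left, abs_neg, Nat.abs_cast]
    exact_mod_cast h3
  rcases he t with h | h
  · exact key _ _ fun i hi => h hi
  · rw [abs_sub_comm, abs_sub_comm ((Finset.univ.filter fun i => y i ≤ t).card : ℝ)]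
    exact key _ _ fun i hi => h hi

/-- The uniform probability measure on the points `x i`, `i ∈ S`, and the Dirac mass at `0` if
there are none. -/
noncomputable def empiricalMeasure {ι : Type*} (S : Finset ι) (x : ι → ℝ) : Measure ℝ :=
  if S.Nonempty then (S.card : ℝ≥0∞)⁻¹ • ∑ i ∈ S, Measure.dirac (x i) else Measure.dirac 0

instance {ι : Type*} (S : Finset ι) (x : ι → ℝ) : IsProbabilityMeasure (empiricalMeasure S x) := by
  unfold empiricalMeasure
  split_ifs with h
  · refine ⟨?_⟩
    simp [ENNReal.inv_mul_cancel, h.ne_empty]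
  · infer_instance

theorem integral_empiricalMeasure {ι E : Type*} [NormedAddCommGroup E] [NormedSpace ℝ E]
    [CompleteSpace E] {S : Finset ι} (hS : S.Nonempty) (x : ι → ℝ) (F : ℝ → E) :
    ∫ y, F y ∂(empiricalMeasure S x) = (S.card : ℝ)⁻¹ • ∑ i ∈ S, F (x i) := by
  rw [empiricalMeasure, if_pos hS, integral_smul_measure, integral_finsetSum_measure]
  · simp
  · exact fun i _ => integrable_dirac (by simp)

theorem empiricalMeasure_real_Iic {ι : Type*} {S : Finset ι} (hS : S.Nonempty) (x : ι → ℝ)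
    (t : ℝ) : (empiricalMeasure S x).real (Set.Iic t)
      = ((S.filter fun i => x i ≤ t).card : ℝ) / S.card := by
  rw [← integral_indicator_one measurableSet_Iic, integral_empiricalMeasure hS]
  simp [Set.indicator_apply, div_eq_inv_mul]

/-- Vague convergence to a probability measure implies convergence of the distribution functions
at the points which are not atoms of the limit. -/
theorem tendsto_real_Iic_of_tendsto_integral_of_hasCompactSupport
    {ι : Type*} {l : Filter ι} {μ : Measure ℝ} {μs : ι → Measure ℝ}
    [IsProbabilityMeasure μ] [∀ i, IsProbabilityMeasure (μs i)]
    (h : ∀ F : ℝ → ℝ, Continuous F → HasCompactSupport F →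
      Tendsto (fun i => ∫ x, F x ∂(μs i)) l (𝓝 (∫ x, F x ∂μ)))
    {t : ℝ} (ht : μ {t} = 0) :
    Tendsto (fun i => (μs i).real (Set.Iic t)) l (𝓝 (μ.real (Set.Iic t))) :=
  (ENNReal.tendsto_toReal (measure_ne_top μ _)).comp
    (tendsto_measure_of_null_frontier
      (fun _ hG => measure_le_liminf_of_tendsto_integral_of_hasCompactSupport h hG)
      (by rwa [frontier_Iic]))

/-- The distribution of `g` under the uniform probability measure on `[a, b]`. -/
noncomputable def uniformLaw (a b : ℝ) (g : ℝ → ℝ) : Measure ℝ :=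
  (ProbabilityTheory.cond volume (Set.Icc a b)).map g

theorem isProbabilityMeasure_uniformLaw {a b : ℝ} (hab : a < b) {g : ℝ → ℝ} (hg : Measurable g) :
    IsProbabilityMeasure (uniformLaw a b g) := by
  have : IsProbabilityMeasure (ProbabilityTheory.cond volume (Set.Icc a b)) :=
    ProbabilityTheory.cond_isProbabilityMeasure_of_finite (by simpa using hab) (by simp)
  exact Measure.isProbabilityMeasure_map hg.aemeasurable

theorem integral_uniformLaw {a b : ℝ} (hab : a < b) {g : ℝ → ℝ} (hg : Measurable g)
    {F : ℝ → ℂ} (hF : Continuous F) :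
    ∫ x, F x ∂(uniformLaw a b g) = ((b - a)⁻¹ : ℝ) • ∫ y in Set.Icc a b, F (g y) := by
  rw [uniformLaw, integral_map hg.aemeasurable hF.aestronglyMeasurable, ProbabilityTheory.cond,
    integral_smul_measure]
  simp [ENNReal.toReal_inv, ENNReal.toReal_ofReal, hab.le]

/-- The average of finitely many measures. -/
noncomputable def averageMeasure {k : ℕ} (ν : Fin k → Measure ℝ) : Measure ℝ :=
  (k : ℝ≥0∞)⁻¹ • ∑ j, ν j

theorem isProbabilityMeasure_averageMeasure {k : ℕ} (hk : 0 < k) (ν : Fin k → Measure ℝ)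
    [∀ j, IsProbabilityMeasure (ν j)] : IsProbabilityMeasure (averageMeasure ν) := by
  refine ⟨?_⟩
  simp [averageMeasure, ENNReal.inv_mul_cancel, hk.ne']

theorem averageMeasure_real {k : ℕ} (ν : Fin k → Measure ℝ) [∀ j, IsProbabilityMeasure (ν j)]
    (s : Set ℝ) : (averageMeasure ν).real s = (k : ℝ)⁻¹ * ∑ j, (ν j).real s := by
  simp [averageMeasure, measureReal_def, ENNReal.toReal_sum]

theorem integral_averageMeasure {k : ℕ} (ν : Fin k → Measure ℝ)
    [∀ j, IsProbabilityMeasure (ν j)] {F : ℝ → ℂ} (hF : Continuous F)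
    (hFc : HasCompactSupport F) :
    ∫ x, F x ∂(averageMeasure ν) = (k : ℂ)⁻¹ * ∑ j, ∫ x, F x ∂(ν j) := by
  rw [averageMeasure, integral_smul_measure, integral_finsetSum_measure
    fun j _ => hF.integrable_of_hasCompactSupport hFc]
  simp

/-- A family with counting function asymptotic to that of an average of probability measures can
be split into subfamilies of prescribed sizes, whose counting functions are asymptotic to those
of the given measures. -/
theorem exists_partition_tendsto_card {k : ℕ} (hk : 0 < k) (ν : Fin k → Measure ℝ)
    [∀ j, IsProbabilityMeasure (ν j)] {d : ℕ → ℕ} (hd : Tendsto d atTop atTop)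
    (y : ∀ n, Fin (d n) → ℝ) {L : ℕ → Fin k → ℕ} (hLsum : ∀ n, ∑ j, L n j = d n)
    (hLlim : ∀ j, Tendsto (fun n => (L n j : ℝ) / d n) atTop (𝓝 (1 / k))) :
    ∃ q : ∀ n, Fin (d n) → Fin k,
      (∀ j n, (Finset.univ.filter fun i => q n i = j).card = L n j) ∧
      ∀ t, Tendsto (fun n => ((Finset.univ.filter fun i => y n i ≤ t).card : ℝ) / d n) atTop
          (𝓝 ((averageMeasure ν).real (Set.Iic t))) →
        ∀ j, Tendsto (fun n => ((Finset.univ.filter fun i => q n i = j ∧ y n i ≤ t).card : ℝ)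
          / L n j) atTop (𝓝 ((ν j).real (Set.Iic t))) := by
  choose x hx using fun n j => exists_points_card_sub_le (ν j) (L n j)
  choose e he using fun n => exists_equiv_card_filter_sub_le
    (ι := Σ j, Fin (L n j)) (d := d n) (by simp [hLsum]) (y n) (fun s => x n s.1 s.2)
  have hcount (n : ℕ) (j : Fin k) (t : ℝ) :
      (Finset.univ.filter fun s : Σ j, Fin (L n j) => s.1 = j ∧ x n s.1 s.2 ≤ t).card
        = (Finset.univ.filter fun i => x n j i ≤ t).card := by
    refine (Finset.card_bij (fun i _ => ⟨j, i⟩) ?_ ?_ ?_).symm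
    · simp
    · simp
    · rintro ⟨j', i⟩ hi
      simp only [Finset.mem_filter_univ] at hi
      obtain ⟨rfl, hi⟩ := hi
      exact ⟨i, by simpa using hi, rfl⟩
  have hcountsum (n : ℕ) (t : ℝ) :
      (Finset.univ.filter fun s : Σ j, Fin (L n j) => x n s.1 s.2 ≤ t).card
        = ∑ j, (Finset.univ.filter fun i => x n j i ≤ t).card := by
    rw [Finset.card_eq_sum_card_fiberwise (f := Sigma.fst) (t := Finset.univ) (by simp)]
    refine Finset.sum_congr rfl fun j _ => ?_
    rw [← hcount, Finset.filter_filter]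
    simp only [and_comm]
  refine ⟨fun n i => (e n i).1, fun j n => ?_, fun t ht j => ?_⟩
  · rw [Finset.card_equiv (t := Finset.univ.filter fun s : Σ j, Fin (L n j) => s.1 = j) (e n)
      (by simp)]
    have hbij := Finset.card_bij (s := (Finset.univ : Finset (Fin (L n j))))
      (t := Finset.univ.filter fun s : Σ j, Fin (L n j) => s.1 = j) (fun i _ => ⟨j, i⟩)
      (by simp) (by simp) fun ⟨j', i⟩ hi => by
        simp only [Finset.mem_filter_univ] at hi
        subst hi
        exact ⟨i, by simp, rfl⟩
    rw [← hbij, Finset.card_univ, Fintype.card_fin]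
  · have hdR : Tendsto (fun n => (d n : ℝ)) atTop atTop := tendsto_natCast_atTop_atTop.comp hd
    have hkR : (0 : ℝ) < k := by exact_mod_cast hk
    have href (j : Fin k) : Tendsto (fun n =>
        ((Finset.univ.filter fun i => x n j i ≤ t).card : ℝ) / d n) atTop
        (𝓝 (1 / k * (ν j).real (Set.Iic t))) := by
      refine ((hLlim j).mul_const _).congr_dist (squeeze_zero (fun _ => dist_nonneg) (fun n => ?_)
        hdR.inv_tendsto_atTop)
      rw [dist_comm, Real.dist_eq, div_mul_eq_mul_div, ← sub_div, abs_div, Nat.abs_cast,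
        Pi.inv_apply, ← one_div]
      gcongr
      exact hx n j t
    have hreftot : Tendsto (fun n =>
        ((Finset.univ.filter fun s : Σ j, Fin (L n j) => x n s.1 s.2 ≤ t).card : ℝ) / d n) atTop
        (𝓝 ((averageMeasure ν).real (Set.Iic t))) := by
      rw [averageMeasure_real, Finset.mul_sum]
      simp only [hcountsum, Nat.cast_sum, Finset.sum_div]
      simpa only [one_div] using tendsto_finsetSum Finset.univ fun j _ => href j
    have hdiff := (ht.sub hreftot).abs
    rw [sub_self, abs_zero] at hdiff
    have hpart : Tendsto (fun n =>
        ((Finset.univ.filter fun i => (e n i).1 = j ∧ y n i ≤ t).card : ℝ) / d n) atTop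
        (𝓝 (1 / k * (ν j).real (Set.Iic t))) := by
      refine (href j).congr_dist (squeeze_zero (fun _ => dist_nonneg) (fun n => ?_) hdiff)
      rw [dist_comm, Real.dist_eq, ← sub_div, ← sub_div, abs_div, abs_div, ← hcount]
      refine div_le_div_of_nonneg_right ?_ (abs_nonneg _)
      exact he n (fun s => s.1 = j) t
    have hquot := hpart.div (hLlim j) (by positivity)
    rw [mul_div_cancel_left₀ _ (by positivity)] at hquot
    refine hquot.congr' ?_
    filter_upwards [hd.eventually_gt_atTop 0] with n hn
    exact div_div_div_cancel_right₀ (by positivity) _ _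

/-- (Lemma `ss1`.) Let `f_1,…,f_k : [a,b] → ℝ` be measurable, let
`{Λ_n}_n ∼ diag(f_1,…,f_k)`, and let `L_{n,1},…,L_{n,k}` be natural numbers with
`L_{n,1} + … + L_{n,k} = d_n` and `L_{n,j}/d_n → 1/k`. Then for every `n` there is a
partition `{Λ_{n,1},…,Λ_{n,k}}` of `Λ_n` (encoded by an assignment `q n : Fin (d_n) → Fin k`)
with `|Λ_{n,j}| = L_{n,j}` and `{Λ_{n,j}}_n ∼ f_j` for every `j`. -/
theorem stmt_4
    (a b : ℝ) (hab : a < b) (k : ℕ) (hk : 0 < k)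
    (f : Fin k → ℝ → ℝ) (hf : ∀ j, Measurable (f j))
    (dn : ℕ → ℕ) (hd : Tendsto dn atTop atTop)
    (lam : ∀ n, Fin (dn n) → ℝ)
    (hdistr : ∀ F : ℝ → ℂ, Continuous F → HasCompactSupport F →
      Tendsto (fun n => (dn n : ℂ)⁻¹ * ∑ i : Fin (dn n), F (lam n i)) atTop
        (nhds (((b - a)⁻¹ : ℝ) • ∫ y in Set.Icc a b, (∑ j : Fin k, F (f j y)) / (k : ℂ))))
    (L : ℕ → Fin k → ℕ)
    (hLsum : ∀ n, ∑ j : Fin k, L n j = dn n)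
    (hLlim : ∀ j, Tendsto (fun n => (L n j : ℝ) / (dn n : ℝ)) atTop (nhds (1 / (k : ℝ)))) :
    ∃ q : ∀ n, Fin (dn n) → Fin k, ∀ j : Fin k,
      (∀ n, (Finset.univ.filter (fun i => q n i = j)).card = L n j) ∧
      (∀ F : ℝ → ℂ, Continuous F → HasCompactSupport F →
        Tendsto (fun n => ((L n j : ℂ))⁻¹ *
            ∑ i ∈ Finset.univ.filter (fun i => q n i = j), F (lam n i)) atTop
          (nhds (((b - a)⁻¹ : ℝ) • ∫ y in Set.Icc a b, F (f j y)))) := by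
  have hν (j : Fin k) : IsProbabilityMeasure (uniformLaw a b (f j)) :=
    isProbabilityMeasure_uniformLaw hab (hf j)
  set ν : Fin k → Measure ℝ := fun j => uniformLaw a b (f j)
  have hμ : IsProbabilityMeasure (averageMeasure ν) := isProbabilityMeasure_averageMeasure hk ν
  have hkR : (0 : ℝ) < k := by exact_mod_cast hk
  have huniv : ∀ᶠ n in atTop, (Finset.univ : Finset (Fin (dn n))).Nonempty := by
    filter_upwards [hd.eventually_gt_atTop 0] with n hn
    exact ⟨⟨0, hn⟩, Finset.mem_univ _⟩
  have hvague (F : ℝ → ℝ) (hF : Continuous F) (hFc : HasCompactSupport F) :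
      Tendsto (fun n => ∫ x, F x ∂(empiricalMeasure Finset.univ (lam n))) atTop
        (𝓝 (∫ x, F x ∂(averageMeasure ν))) := by
    have hG : Continuous fun x => (F x : ℂ) := Complex.continuous_ofReal.comp hF
    have hGc : HasCompactSupport fun x => (F x : ℂ) := hFc.comp_left Complex.ofReal_zero
    have hint (j : Fin k) :
        Integrable (fun y => (F (f j y) : ℂ)) (volume.restrict (Set.Icc a b)) := by
      obtain ⟨C, hC⟩ := hGc.exists_bound_of_continuous hG
      exact Integrable.of_bound (hG.measurable.comp (hf j)).aestronglyMeasurable C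
        (.of_forall fun y => hC _)
    have hlim := hdistr _ hG hGc
    rw [integral_div, integral_finsetSum _ fun j _ => hint j] at hlim
    rw [← tendsto_ofReal_iff]
    simp only [← integral_complex_ofReal]
    rw [integral_averageMeasure ν hG hGc]
    simp only [ν, integral_uniformLaw hab (hf _) hG, ← Finset.smul_sum]
    rw [mul_smul_comm, ← div_eq_inv_mul]
    refine hlim.congr' ?_
    filter_upwards [huniv] with n hn
    rw [integral_empiricalMeasure hn]
    simp
  have hcdf (t : ℝ) (ht : averageMeasure ν {t} = 0) : Tendsto (fun n =>
      ((Finset.univ.filter fun i => lam n i ≤ t).card : ℝ) / dn n) atTop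
      (𝓝 ((averageMeasure ν).real (Set.Iic t))) := by
    refine (tendsto_real_Iic_of_tendsto_integral_of_hasCompactSupport hvague ht).congr' ?_
    filter_upwards [huniv] with n hn
    simp [empiricalMeasure_real_Iic hn]
  obtain ⟨q, hqcard, hq⟩ := exists_partition_tendsto_card hk ν hd lam hLsum hLlim
  refine ⟨q, fun j => ⟨hqcard j, fun F hF hFc => ?_⟩⟩
  have hnonempty : ∀ᶠ n in atTop, (Finset.univ.filter fun i => q n i = j).Nonempty := by
    filter_upwards [(hLlim j).eventually_const_lt (show (0 : ℝ) < 1 / k by positivity)] with n hn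
    rw [← Finset.card_pos, hqcard]
    by_contra! h
    simp [Nat.le_zero.1 h] at hn
  have hweak : Tendsto (β := ProbabilityMeasure ℝ)
      (fun n => ⟨empiricalMeasure (Finset.univ.filter fun i => q n i = j) (lam n), inferInstance⟩)
      atTop (𝓝 ⟨ν j, hν j⟩) := by
    refine tendsto_probabilityMeasure_of_tendsto_Iic
      (dense_setOf_measure_singleton_eq_zero (averageMeasure ν)) fun t ht => ?_
    refine (hq t (hcdf t ht) j).congr' ?_
    filter_upwards [hnonempty] with n hn
    simp [empiricalMeasure_real_Iic hn, hqcard, Finset.filter_filter]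
  obtain ⟨C, hC⟩ := hFc.exists_bound_of_continuous hF
  have hlim := (ProbabilityMeasure.tendsto_iff_forall_integral_rclike_tendsto ℂ).1 hweak
    (BoundedContinuousFunction.ofNormedAddCommGroup F hF C hC)
  simp only [BoundedContinuousFunction.coe_ofNormedAddCommGroup, ProbabilityMeasure.coe_mk] at hlim
  rw [integral_uniformLaw hab (hf j) hF] at hlim
  refine hlim.congr' ?_
  filter_upwards [hnonempty] with n hn
  rw [integral_empiricalMeasure hn, hqcard]
  simp
end
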